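/- arXiv:math/0002186 — 2 statements merged into one kernel-verified Lean document; each statement's English description precedes it below -/
import Mathlib

section
/- (Wavrik approximation) Let h_j(x,y,u) ∈ ℝ[x][[y,u]], 1 ≤ j ≤ j_0, be formal power series in y = (y_1,…,y_β) and u = (u_1,…,u_γ) with coefficients which are polynomials in x = (x_1,…,x_α). Then for any integer κ ≥ 1 there exists an integer η ≥ 1 such that, for any formal power series x^a(u) ∈ (ℝ[[u]])^α and y^a(u) ∈ (ℝ[[u]])^β satisfying y^a(0) = 0 and h_j(x^a(u), y^a(u), u) = O(|u|^η) for 1 ≤ j ≤ j_0, there exist formal power series x^f(u) ∈ (ℝ[[u]])^α and y^f(u) ∈ (ℝ[[u]])^β satisfying x^f(u) = x^a(u) + O(|u|^κ), y^f(u) = y^a(u) + O(|u|^κ), and h_j(x^f(u), y^f(u), u) ≡ 0 for 1 ≤ j ≤ j_0. -/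
open scoped BigOperators

noncomputable section

/-- The polynomial map obtained by truncating to order `< k` the formal power series
(centered at `0`) with coefficient family `c`. -/
def truncPoly (γ δ : ℕ) (c : (Fin γ → ℕ) → (Fin δ → ℝ)) (k : ℕ) :
    (Fin γ → ℝ) → (Fin δ → ℝ) := fun u i =>
  ∑ dd ∈ (Fintype.piFinset fun _ : Fin γ => Finset.range k).filter
      (fun dd => (∑ j, dd j) < k),
    c dd i * ∏ j, (u j) ^ dd j

/-- Given `h ∈ ℝ[x][[y,u]]` (recorded by its coefficient family of polynomials in `x`)
and formal power series `x(u)`, `y(u)`, the truncation at level `η` of the formal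
composite `h(x(u), y(u), u)`: its Taylor coefficients of degree `< η` agree with those of
the formal composite. -/
def compTrunc (a b g : ℕ) (h : ((Fin b → ℕ) × (Fin g → ℕ)) → MvPolynomial (Fin a) ℝ)
    (x : (Fin g → ℕ) → (Fin a → ℝ)) (y : (Fin g → ℕ) → (Fin b → ℝ)) (η : ℕ) :
    (Fin g → ℝ) → ℝ := fun u =>
  ∑ bc ∈ (((Fintype.piFinset fun _ : Fin b => Finset.range η) ×ˢ
      (Fintype.piFinset fun _ : Fin g => Finset.range η)).filter
      (fun bc => (∑ i, bc.1 i) + (∑ j, bc.2 j) < η)),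
    (MvPolynomial.eval (truncPoly g a x η u) (h bc)) *
      (∏ i, (truncPoly g b y η u i) ^ bc.1 i) * ∏ j, (u j) ^ bc.2 j

/-- A multiplicative filtration of a commutative ring by ideals, for which the ring is
separated and complete. -/
structure CompleteFiltration (B : Type) [CommRing B] where
  /-- The ideals of the filtration. -/
  F : ℕ → Ideal B
  zero' : F 0 = ⊤
  succ_le : ∀ n, F (n + 1) ≤ F n
  mul' : ∀ m n a b, a ∈ F m → b ∈ F n → a * b ∈ F (m + n)
  sep : ∀ a, (∀ n, a ∈ F n) → a = 0
  complete : ∀ a : ℕ → B, (∀ n, a (n + 1) - a n ∈ F n) → ∃ l, ∀ n, l - a n ∈ F n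

namespace CompleteFiltration

variable {B : Type} [CommRing B] (𝓕 : CompleteFiltration B)

lemma anti {m n : ℕ} (h : m ≤ n) : 𝓕.F n ≤ 𝓕.F m := antitone_nat_of_succ_le 𝓕.succ_le h

lemma mem_zero (a : B) : a ∈ 𝓕.F 0 := by rw [𝓕.zero']; trivial

lemma mul_succ {n : ℕ} {a b : B} (ha : a ∈ 𝓕.F 1) (hb : b ∈ 𝓕.F n) : a * b ∈ 𝓕.F (n + 1) := by
  have := 𝓕.mul' 1 n a b ha hb
  rwa [add_comm] at this

lemma pow_mem {a : B} (ha : a ∈ 𝓕.F 1) (n : ℕ) : a ^ n ∈ 𝓕.F n := by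
  induction n with
  | zero => exact 𝓕.mem_zero _
  | succ n ih => rw [pow_succ']; exact 𝓕.mul_succ ha ih

/-- A contraction on finite tuples has a fixed point. -/
lemma exists_fixedPoint {ι : Type} (T : (ι → B) → ι → B)
    (hT : ∀ n z z', (∀ i, z i - z' i ∈ 𝓕.F n) → ∀ i, T z i - T z' i ∈ 𝓕.F (n + 1)) :
    ∃ z, T z = z := by
  let a : ℕ → ι → B := fun n => T^[n] 0
  have ha : ∀ n i, a (n + 1) i - a n i ∈ 𝓕.F n := by
    intro n
    induction n with
    | zero => intro i; exact 𝓕.mem_zero _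
    | succ n ih =>
      intro i
      have := hT n _ _ ih i
      simpa only [a, Function.iterate_succ_apply'] using this
  choose z hz using fun i => 𝓕.complete (fun n => a n i) (fun n => ha n i)
  refine ⟨z, ?_⟩
  funext i
  rw [← sub_eq_zero]
  apply 𝓕.sep
  intro n
  have h1 := hT n z (a n) (fun i => hz i n) i
  have h2 := hz i (n + 1)
  have h3 : T (a n) i = a (n + 1) i := by simp only [a, Function.iterate_succ_apply']
  rw [h3] at h1
  have := Ideal.sub_mem _ h1 h2
  apply 𝓕.succ_le
  convert this using 1
  ring

lemma fixedPoint_unique {ι : Type} (T : (ι → B) → ι → B)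
    (hT : ∀ n z z', (∀ i, z i - z' i ∈ 𝓕.F n) → ∀ i, T z i - T z' i ∈ 𝓕.F (n + 1))
    {z z' : ι → B} (hz : T z = z) (hz' : T z' = z') : z = z' := by
  have : ∀ n i, z i - z' i ∈ 𝓕.F n := by
    intro n
    induction n with
    | zero => intro i; exact 𝓕.mem_zero _
    | succ n ih =>
      intro i
      have := hT n _ _ ih i
      rwa [hz, hz'] at this
  funext i
  rw [← sub_eq_zero]
  exact 𝓕.sep _ (fun n => this n i)

end CompleteFiltration

/-- The order filtration on multivariate power series. -/
def orderFiltration (τ R : Type) [CommRing R] : CompleteFiltration (MvPowerSeries τ R) where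
  F n :=
    { carrier := {f | ∀ e, e.degree < n → MvPowerSeries.coeff e f = 0}
      add_mem' := by
        intro a b ha hb e he
        rw [map_add, ha e he, hb e he, add_zero]
      zero_mem' := by intro e _; simp
      smul_mem' := by
        classical
        intro c x hx e he
        rw [smul_eq_mul, MvPowerSeries.coeff_mul]
        apply Finset.sum_eq_zero
        intro p hp
        rw [Finset.HasAntidiagonal.mem_antidiagonal] at hp
        rw [hx p.2 (lt_of_le_of_lt _ he), mul_zero]
        rw [← hp, map_add]
        exact Nat.le_add_left _ _ }
  zero' := by
    rw [Ideal.eq_top_iff_one]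
    intro e he
    simp at he
  succ_le n f hf e he := hf e (Nat.lt_succ_of_lt he)
  mul' := by
    classical
    intro m n a b ha hb e he
    rw [MvPowerSeries.coeff_mul]
    apply Finset.sum_eq_zero
    intro p hp
    rw [Finset.HasAntidiagonal.mem_antidiagonal] at hp
    rw [← hp, map_add] at he
    by_cases h : p.1.degree < m
    · rw [ha _ h, zero_mul]
    · rw [hb _ (by omega), mul_zero]
  sep := by
    intro a ha
    ext e
    exact ha (e.degree + 1) e (Nat.lt_succ_self _)
  complete := by
    intro a ha
    let L : MvPowerSeries τ R := fun e => MvPowerSeries.coeff e (a (e.degree + 1))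
    have hL : ∀ e, MvPowerSeries.coeff e L = MvPowerSeries.coeff e (a (e.degree + 1)) :=
      fun _ => rfl
    refine ⟨L, ?_⟩
    intro n e he
    have key : ∀ m, e.degree + 1 ≤ m →
        MvPowerSeries.coeff e (a m) = MvPowerSeries.coeff e (a (e.degree + 1)) := by
      intro m hm
      induction m, hm using Nat.le_induction with
      | base => rfl
      | succ m hm ih =>
        have := ha m e (by omega)
        rw [map_sub, sub_eq_zero] at this
        rw [this, ih]
    rw [map_sub, key n he, hL, sub_self]

lemma X_mem_orderFiltration {τ R : Type} [CommRing R] (t : τ) :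
    (MvPowerSeries.X t : MvPowerSeries τ R) ∈ (orderFiltration τ R).F 1 := by
  intro e he
  have : e = 0 := by
    rw [← Finsupp.degree_eq_zero_iff]; omega
  subst this
  simp

lemma mem_orderFiltration_one {τ R : Type} [CommRing R] {f : MvPowerSeries τ R} :
    f ∈ (orderFiltration τ R).F 1 ↔ MvPowerSeries.constantCoeff f = 0 := by
  constructor
  · intro h
    exact h 0 (by simp)
  · intro h e he
    have : e = 0 := by
      rw [← Finsupp.degree_eq_zero_iff]; omega
    subst this
    exact h

/-- The filtration on power series in which the variable has degree one. -/
def CompleteFiltration.powerSeries {B : Type} [CommRing B] (𝓕 : CompleteFiltration B) :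
    CompleteFiltration (PowerSeries B) where
  F n :=
    { carrier := {f | ∀ i, PowerSeries.coeff i f ∈ 𝓕.F (n - i)}
      add_mem' := by
        intro a b ha hb i
        rw [map_add]
        exact Ideal.add_mem _ (ha i) (hb i)
      zero_mem' := by intro i; simp
      smul_mem' := by
        intro c x hx i
        rw [smul_eq_mul, PowerSeries.coeff_mul]
        apply Ideal.sum_mem
        intro p hp
        rw [Finset.HasAntidiagonal.mem_antidiagonal] at hp
        apply Ideal.mul_mem_left
        exact 𝓕.anti (by omega) (hx p.2) }
  zero' := by
    rw [Ideal.eq_top_iff_one]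
    intro i
    rw [Nat.zero_sub]
    exact 𝓕.mem_zero _
  succ_le n f hf i := 𝓕.anti (by omega) (hf i)
  mul' := by
    intro m n a b ha hb i
    rw [PowerSeries.coeff_mul]
    apply Ideal.sum_mem
    intro p hp
    rw [Finset.HasAntidiagonal.mem_antidiagonal] at hp
    exact 𝓕.anti (by omega) (𝓕.mul' _ _ _ _ (ha p.1) (hb p.2))
  sep := by
    intro a ha
    ext i
    rw [map_zero]
    apply 𝓕.sep
    intro n
    have := ha (n + i) i
    rwa [Nat.add_sub_cancel] at this
  complete := by
    intro a ha
    have h1 : ∀ i, ∃ l, ∀ n, l - PowerSeries.coeff i (a (n + i)) ∈ 𝓕.F n := by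
      intro i
      apply 𝓕.complete (fun n => PowerSeries.coeff i (a (n + i)))
      intro n
      have := ha (n + i) i
      rw [Nat.add_sub_cancel, map_sub] at this
      rwa [show n + 1 + i = n + i + 1 by ring]
    choose l hl using h1
    refine ⟨PowerSeries.mk l, ?_⟩
    intro n i
    rw [map_sub, PowerSeries.coeff_mk]
    by_cases h : i ≤ n
    · have := hl i (n - i)
      rwa [Nat.sub_add_cancel h] at this
    · rw [Nat.sub_eq_zero_of_le (by omega)]
      exact 𝓕.mem_zero _

/-- The filtration on power series in which the variable has degree zero. -/
def CompleteFiltration.coeffs {B : Type} [CommRing B] (𝓕 : CompleteFiltration B) :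
    CompleteFiltration (PowerSeries B) where
  F n :=
    { carrier := {f | ∀ i, PowerSeries.coeff i f ∈ 𝓕.F n}
      add_mem' := by
        intro a b ha hb i
        rw [map_add]
        exact Ideal.add_mem _ (ha i) (hb i)
      zero_mem' := by intro i; simp
      smul_mem' := by
        intro c x hx i
        rw [smul_eq_mul, PowerSeries.coeff_mul]
        apply Ideal.sum_mem
        intro p hp
        apply Ideal.mul_mem_left
        exact hx p.2 }
  zero' := by
    rw [Ideal.eq_top_iff_one]
    intro i
    exact 𝓕.mem_zero _
  succ_le n f hf i := 𝓕.succ_le n (hf i)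
  mul' := by
    intro m n a b ha hb i
    rw [PowerSeries.coeff_mul]
    apply Ideal.sum_mem
    intro p hp
    exact 𝓕.mul' _ _ _ _ (ha p.1) (hb p.2)
  sep := by
    intro a ha
    ext i
    rw [map_zero]
    exact 𝓕.sep _ (fun n => ha n i)
  complete := by
    intro a ha
    choose l hl using fun i => 𝓕.complete (fun n => PowerSeries.coeff i (a n))
      (fun n => by have := ha n i; rwa [map_sub] at this)
    refine ⟨PowerSeries.mk l, ?_⟩
    intro n i
    rw [map_sub, PowerSeries.coeff_mk]
    exact hl i n

lemma CompleteFiltration.coeffs_le_powerSeries {B : Type} [CommRing B]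
    (𝓕 : CompleteFiltration B) (n : ℕ) : 𝓕.coeffs.F n ≤ 𝓕.powerSeries.F n :=
  fun _ hf i => 𝓕.anti (Nat.sub_le _ _) (hf i)

lemma CompleteFiltration.X_mem_powerSeries {B : Type} [CommRing B]
    (𝓕 : CompleteFiltration B) : (PowerSeries.X : PowerSeries B) ∈ 𝓕.powerSeries.F 1 := by
  intro i
  rw [PowerSeries.coeff_X]
  split_ifs with h
  · subst h; exact 𝓕.mem_zero _
  · exact Ideal.zero_mem _

lemma CompleteFiltration.mem_powerSeries_one {B : Type} [CommRing B]
    {𝓕 : CompleteFiltration B} {f : PowerSeries B} (h : PowerSeries.coeff 0 f ∈ 𝓕.F 1) :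
    f ∈ 𝓕.powerSeries.F 1 := by
  intro i
  rcases i with _ | i
  · exact h
  · rw [show 1 - (i + 1) = 0 by omega]; exact 𝓕.mem_zero _

/-- A power series of order at least `n + 1` is a combination of the variables with coefficients
of order at least `n`. -/
lemma exists_eq_sum_X_mul {τ R : Type} [CommRing R] [Fintype τ] {n : ℕ} {g : MvPowerSeries τ R}
    (hg : g ∈ (orderFiltration τ R).F (n + 1)) :
    ∃ h : τ → MvPowerSeries τ R, (∀ t, h t ∈ (orderFiltration τ R).F n) ∧
      g = ∑ t, MvPowerSeries.X t * h t := by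
  classical
  have hsupp : ∀ e : τ →₀ ℕ, e ≠ 0 → ∃ t, e t ≠ 0 := by
    intro e he
    by_contra hcon
    push Not at hcon
    exact he (Finsupp.ext hcon)
  let idx : (τ →₀ ℕ) → Option τ := fun e => if he : e = 0 then none else some (hsupp e he).choose
  have hidx : ∀ e t, idx e = some t → e t ≠ 0 := by
    intro e t h
    simp only [idx] at h
    split_ifs at h with he
    have := (hsupp e he).choose_spec
    rw [Option.some.injEq] at h
    rwa [h] at this
  let h : τ → MvPowerSeries τ R := fun t e =>
    if idx (Finsupp.single t 1 + e) = some t then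
      MvPowerSeries.coeff (Finsupp.single t 1 + e) g else 0
  have hh : ∀ t e, MvPowerSeries.coeff e (h t) =
    if idx (Finsupp.single t 1 + e) = some t then
      MvPowerSeries.coeff (Finsupp.single t 1 + e) g else 0 := fun t e => rfl
  refine ⟨h, ?_, ?_⟩
  · intro t e he
    rw [hh]
    split_ifs
    · apply hg
      rw [map_add, Finsupp.degree_single]
      omega
    · rfl
  · ext e
    rw [map_sum]
    have hX : ∀ t, MvPowerSeries.coeff e (MvPowerSeries.X t * h t) =
        if idx e = some t then MvPowerSeries.coeff e g else 0 := by
      intro t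
      by_cases het : e t = 0
      · rw [if_neg (fun hc => hidx e t hc het)]
        rw [MvPowerSeries.coeff_mul]
        apply Finset.sum_eq_zero
        intro p hp
        rw [Finset.HasAntidiagonal.mem_antidiagonal] at hp
        rw [MvPowerSeries.coeff_X, if_neg, zero_mul]
        intro hc
        rw [← hp, hc] at het
        simp at het
      · have : e = Finsupp.single t 1 + (e - Finsupp.single t 1) := by
          ext s
          by_cases hs : s = t
          · subst hs; simp; omega
          · simp [Ne.symm hs]
        conv_lhs => rw [this]
        rw [MvPowerSeries.X, MvPowerSeries.coeff_add_monomial_mul, one_mul, hh, ← this]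
    simp_rw [hX]
    rcases hi : idx e with _ | t
    · have : e = 0 := by
        by_contra he
        simp [idx, he] at hi
      rw [hg e (by rw [this]; simp)]
      simp
    · simp

lemma eval₂_mem_filtration {τ R B : Type} [CommRing R] [CommRing B] (𝓕 : CompleteFiltration B)
    (ρ : R →+* B) (y : τ → B) (hy : ∀ t, y t ∈ 𝓕.F 1) {n : ℕ}
    {p : MvPolynomial τ R} (hp : ∀ e : τ →₀ ℕ, e.degree < n → p.coeff e = 0) :
    MvPolynomial.eval₂Hom ρ y p ∈ 𝓕.F n := by
  rw [MvPolynomial.coe_eval₂Hom, MvPolynomial.eval₂_eq]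
  apply Ideal.sum_mem
  intro e _
  by_cases he : e.degree < n
  · rw [hp e he]; simp
  · apply Ideal.mul_mem_left
    refine 𝓕.anti (not_lt.mp he) ?_
    rw [Finsupp.degree_apply]
    have : ∀ s : Finset τ, ∏ i ∈ s, y i ^ e i ∈ 𝓕.F (∑ i ∈ s, e i) := by
      classical
      intro s
      induction s using Finset.induction_on with
      | empty => exact 𝓕.mem_zero _
      | insert i s hi ih =>
        rw [Finset.prod_insert hi, Finset.sum_insert hi]
        exact 𝓕.mul' _ _ _ _ (𝓕.pow_mem (hy i) _) ih
    exact this _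

section Hom

variable {τ R B : Type} [CommRing R] [CommRing B] [Fintype τ] (𝓕 : CompleteFiltration B)

lemma ringHom_mem_filtration (θ : MvPowerSeries τ R →+* B)
    (hθ : ∀ t, θ (MvPowerSeries.X t) ∈ 𝓕.F 1) {n : ℕ} :
    ∀ {g : MvPowerSeries τ R}, g ∈ (orderFiltration τ R).F n → θ g ∈ 𝓕.F n := by
  induction n with
  | zero => intro g _; exact 𝓕.mem_zero _
  | succ n ih =>
    intro g hg
    obtain ⟨h, hh, rfl⟩ := exists_eq_sum_X_mul hg
    rw [map_sum]
    apply Ideal.sum_mem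
    intro t _
    rw [map_mul]
    exact 𝓕.mul_succ (hθ t) (ih (hh t))

lemma sub_truncTotal_mem (n : ℕ) (g : MvPowerSeries τ R) :
    g - (MvPowerSeries.truncTotal n g : MvPolynomial τ R) ∈ (orderFiltration τ R).F n := by
  intro e he
  rw [map_sub, MvPolynomial.coeff_coe, MvPowerSeries.coeff_truncTotal _ he, sub_self]

/-- Two homomorphisms which agree on constants and variables modulo a closed ideal agree modulo
this ideal. -/
lemma ringHom_sub_mem (θ θ' : MvPowerSeries τ R →+* B)
    (hθ : ∀ t, θ (MvPowerSeries.X t) ∈ 𝓕.F 1) (hθ' : ∀ t, θ' (MvPowerSeries.X t) ∈ 𝓕.F 1)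
    (J : Ideal B) (hJ : ∀ b, (∀ n, ∃ c ∈ 𝓕.F n, b - c ∈ J) → b ∈ J)
    (hC : ∀ r, θ (MvPowerSeries.C r) - θ' (MvPowerSeries.C r) ∈ J)
    (hX : ∀ t, θ (MvPowerSeries.X t) - θ' (MvPowerSeries.X t) ∈ J) (g : MvPowerSeries τ R) :
    θ g - θ' g ∈ J := by
  have hpol : ∀ p : MvPolynomial τ R, θ p - θ' p ∈ J := by
    intro p
    have : ((Ideal.Quotient.mk J).comp θ).comp MvPolynomial.coeToMvPowerSeries.ringHom =
        ((Ideal.Quotient.mk J).comp θ').comp MvPolynomial.coeToMvPowerSeries.ringHom := by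
      apply MvPolynomial.ringHom_ext
      · intro r
        simpa [Ideal.Quotient.mk_eq_mk_iff_sub_mem] using hC r
      · intro t
        simpa [Ideal.Quotient.mk_eq_mk_iff_sub_mem] using hX t
    have := RingHom.congr_fun this p
    simpa [Ideal.Quotient.mk_eq_mk_iff_sub_mem] using this
  apply hJ
  intro n
  have hg := sub_truncTotal_mem n g
  set p := MvPowerSeries.truncTotal n g
  refine ⟨θ (g - p) - θ' (g - p), Ideal.sub_mem _ (ringHom_mem_filtration 𝓕 θ hθ hg)
    (ringHom_mem_filtration 𝓕 θ' hθ' hg), ?_⟩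
  have : θ g - θ' g - (θ (g - p) - θ' (g - p)) = θ p - θ' p := by
    rw [map_sub, map_sub]; ring
  rw [this]
  exact hpol p

/-- Evaluation of power series at topologically nilpotent elements. -/
lemma exists_eval (ρ : R →+* B) (y : τ → B) (hy : ∀ t, y t ∈ 𝓕.F 1) :
    ∃ θ : MvPowerSeries τ R →+* B, (∀ r, θ (MvPowerSeries.C r) = ρ r) ∧
      ∀ t, θ (MvPowerSeries.X t) = y t := by
  let E := MvPolynomial.eval₂Hom ρ y
  have hlow : ∀ {n : ℕ} {p q : MvPolynomial τ R},
      (∀ e : τ →₀ ℕ, e.degree < n → p.coeff e = q.coeff e) → E p - E q ∈ 𝓕.F n := by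
    intro n p q h
    rw [← map_sub]
    apply eval₂_mem_filtration 𝓕 ρ y hy
    intro e he
    rw [MvPolynomial.coeff_sub, h e he, sub_self]
  have hex : ∀ g : MvPowerSeries τ R, ∃ l, ∀ n,
      l - E (MvPowerSeries.truncTotal n g) ∈ 𝓕.F n := by
    intro g
    apply 𝓕.complete (fun n => E (MvPowerSeries.truncTotal n g))
    intro n
    apply hlow
    intro e he
    rw [MvPowerSeries.coeff_truncTotal _ he, MvPowerSeries.coeff_truncTotal _ (by omega)]
  choose L hL using hex
  have huniq : ∀ g l, (∀ n, l - E (MvPowerSeries.truncTotal n g) ∈ 𝓕.F n) → L g = l := by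
    intro g l hl
    rw [← sub_eq_zero]
    apply 𝓕.sep
    intro n
    have := Ideal.sub_mem _ (hL g n) (hl n)
    convert this using 1; ring
  have hpoly : ∀ p : MvPolynomial τ R, L p = E p := by
    intro p
    apply huniq
    intro n
    apply hlow
    intro e he
    rw [MvPowerSeries.coeff_truncTotal _ he, MvPolynomial.coeff_coe]
  refine ⟨⟨⟨⟨L, ?_⟩, ?_⟩, ?_, ?_⟩, ?_, ?_⟩
  · simpa using hpoly 1
  · intro g h
    apply huniq
    intro n
    have h1 := Ideal.add_mem _ (Ideal.mul_mem_right (L h) _ (hL g n))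
      (Ideal.mul_mem_left _ (E (MvPowerSeries.truncTotal n g)) (hL h n))
    have h2 : E (MvPowerSeries.truncTotal n g * MvPowerSeries.truncTotal n h) -
        E (MvPowerSeries.truncTotal n (g * h)) ∈ 𝓕.F n := by
      apply hlow
      intro e he
      rw [MvPowerSeries.coeff_truncTotal_mul_truncTotal_eq_coeff_mul _ _ he,
        MvPowerSeries.coeff_truncTotal _ he]
    rw [map_mul] at h2
    convert Ideal.add_mem _ h1 h2 using 1; ring
  · simpa using hpoly 0
  · intro g h
    apply huniq
    intro n
    rw [map_add, map_add]
    convert Ideal.add_mem _ (hL g n) (hL h n) using 1; ring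
  · intro r
    simpa [E] using hpoly (MvPolynomial.C r)
  · intro t
    simpa [E] using hpoly (MvPolynomial.X t)

/-- A derivation along a homomorphism which kills constants and variables vanishes. -/
lemma derivation_eq_zero (θ : MvPowerSeries τ R →+* B)
    (hθ : ∀ t, θ (MvPowerSeries.X t) ∈ 𝓕.F 1) (D : MvPowerSeries τ R →+ B)
    (hD : ∀ a b, D (a * b) = θ a * D b + θ b * D a)
    (hC : ∀ r, D (MvPowerSeries.C r) = 0) (hX : ∀ t, D (MvPowerSeries.X t) = 0)
    (g : MvPowerSeries τ R) : D g = 0 := by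
  have hmem : ∀ n, ∀ g ∈ (orderFiltration τ R).F n, D g ∈ 𝓕.F n := by
    intro n
    induction n with
    | zero => intro g _; exact 𝓕.mem_zero _
    | succ n ih =>
      intro g hg
      obtain ⟨h, hh, rfl⟩ := exists_eq_sum_X_mul hg
      rw [map_sum]
      apply Ideal.sum_mem
      intro t _
      rw [hD, hX, mul_zero, add_zero]
      exact 𝓕.mul_succ (hθ t) (ih _ (hh t))
  have hpol : ∀ p : MvPolynomial τ R, D p = 0 := by
    intro p
    induction p using MvPolynomial.induction_on with
    | C r => simpa using hC r
    | add p q hp hq => simp [hp, hq]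
    | mul_X p t hp => rw [MvPolynomial.coe_mul, hD, hp, MvPolynomial.coe_X, hX]; simp
  apply 𝓕.sep
  intro n
  have := hmem n _ (sub_truncTotal_mem n g)
  rwa [map_sub, hpol, sub_zero] at this

end Hom

/-- Power series in `β ⊕ υ` with polynomial coefficients in `α`. -/
abbrev PolyPower (k : Type) [CommRing k] (α β υ : Type) : Type :=
  MvPowerSeries (β ⊕ υ) (MvPolynomial α k)

namespace PolyPower

section Basic

variable {k : Type} [CommRing k] {α β υ : Type}

/-- The variables in `α ⊕ β`. -/
def mv (k : Type) [CommRing k] {α β : Type} (υ : Type) : α ⊕ β → PolyPower k α β υ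
  | Sum.inl a => MvPowerSeries.C (MvPolynomial.X a)
  | Sum.inr b => MvPowerSeries.X (Sum.inl b)

/-- The variables in `υ`. -/
def pv (k : Type) [CommRing k] (α β : Type) {υ : Type} (u : υ) : PolyPower k α β υ :=
  MvPowerSeries.X (Sum.inr u)

lemma X_mem (t : β ⊕ υ) : (MvPowerSeries.X t : PolyPower k α β υ) ∈
    (orderFiltration (β ⊕ υ) (MvPolynomial α k)).F 1 := X_mem_orderFiltration t

variable [Fintype β] [Fintype υ] {B : Type} [CommRing B] [Algebra k B] (𝓕 : CompleteFiltration B)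

lemma exists_hom (v : α ⊕ β → B) (w : υ → B) (hv : ∀ b, v (Sum.inr b) ∈ 𝓕.F 1)
    (hw : ∀ u, w u ∈ 𝓕.F 1) :
    ∃ θ : PolyPower k α β υ →ₐ[k] B, (∀ i, θ (mv k υ i) = v i) ∧ (∀ u, θ (pv k α β u) = w u) ∧
      ∀ t, θ (MvPowerSeries.X t) ∈ 𝓕.F 1 := by
  obtain ⟨θ, h1, h2⟩ := exists_eval (τ := β ⊕ υ) 𝓕
    (MvPolynomial.aeval (R := k) (fun a : α => v (Sum.inl a))).toRingHom
    (Sum.elim (fun b => v (Sum.inr b)) w) (by rintro (b | u); exacts [hv b, hw u])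
  refine ⟨{ θ with commutes' := ?_ }, ?_, ?_, ?_⟩
  · intro r
    have := h1 (MvPolynomial.C r)
    rw [MvPowerSeries.algebraMap_apply]
    simpa using this
  · rintro (a | b)
    · exact (h1 _).trans (by simp)
    · exact (h2 _).trans (by simp)
  · intro u
    exact (h2 _).trans (by simp)
  · rintro (b | u)
    · exact (h2 (Sum.inl b)) ▸ hv b
    · exact (h2 (Sum.inr u)) ▸ hw u

lemma hom_sub_mem (θ θ' : PolyPower k α β υ →ₐ[k] B)
    (hθ : ∀ t, θ (MvPowerSeries.X t) ∈ 𝓕.F 1) (hθ' : ∀ t, θ' (MvPowerSeries.X t) ∈ 𝓕.F 1)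
    (J : Ideal B) (hJ : ∀ b, (∀ n, ∃ c ∈ 𝓕.F n, b - c ∈ J) → b ∈ J)
    (hv : ∀ i, θ (mv k υ i) - θ' (mv k υ i) ∈ J)
    (hw : ∀ u, θ (pv k α β u) - θ' (pv k α β u) ∈ J) (g : PolyPower k α β υ) :
    θ g - θ' g ∈ J := by
  apply ringHom_sub_mem 𝓕 θ.toRingHom θ'.toRingHom hθ hθ' J hJ
  · intro r
    have : ((Ideal.Quotient.mkₐ k J).comp θ).comp
          (IsScalarTower.toAlgHom k (MvPolynomial α k) (PolyPower k α β υ)) =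
        ((Ideal.Quotient.mkₐ k J).comp θ').comp
          (IsScalarTower.toAlgHom k (MvPolynomial α k) (PolyPower k α β υ)) := by
      apply MvPolynomial.algHom_ext
      intro a
      have := hv (Sum.inl a)
      rw [← Ideal.Quotient.mk_eq_mk_iff_sub_mem] at this
      exact this
    have := AlgHom.congr_fun this r
    rw [← Ideal.Quotient.mk_eq_mk_iff_sub_mem]
    exact this
  · rintro (b | u)
    · exact hv (Sum.inr b)
    · exact hw u

lemma hom_ext (θ θ' : PolyPower k α β υ →ₐ[k] B)
    (hθ : ∀ t, θ (MvPowerSeries.X t) ∈ 𝓕.F 1) (hθ' : ∀ t, θ' (MvPowerSeries.X t) ∈ 𝓕.F 1)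
    (hv : ∀ i, θ (mv k υ i) = θ' (mv k υ i))
    (hw : ∀ u, θ (pv k α β u) = θ' (pv k α β u)) : θ = θ' := by
  ext g
  have := hom_sub_mem 𝓕 θ θ' hθ hθ' ⊥ ?_ (fun i => by simp [hv]) (fun i => by simp [hw]) g
  · simpa [sub_eq_zero] using this
  · intro b hb
    rw [Ideal.mem_bot]
    apply 𝓕.sep
    intro n
    obtain ⟨c, hc, h⟩ := hb n
    rw [Ideal.mem_bot, sub_eq_zero] at h
    rwa [h]

lemma isClosed_filtration (m : ℕ) (b : B) (h : ∀ n, ∃ c ∈ 𝓕.F n, b - c ∈ 𝓕.F m) : b ∈ 𝓕.F m := by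
  obtain ⟨c, hc, h⟩ := h m
  have := Ideal.add_mem _ h hc
  simpa using this

lemma isClosed_coeffs (m : ℕ) (b : PowerSeries B)
    (h : ∀ n, ∃ c ∈ 𝓕.powerSeries.F n, b - c ∈ 𝓕.coeffs.F m) : b ∈ 𝓕.coeffs.F m := by
  intro i
  obtain ⟨c, hc, h⟩ := h (m + i)
  have h1 := h i
  have h2 := hc i
  rw [Nat.add_sub_cancel] at h2
  have := Ideal.add_mem _ h1 h2
  simpa using this

/-- Homomorphisms agree modulo the filtration if they do so on the variables. -/
lemma hom_sub_mem_filtration (θ θ' : PolyPower k α β υ →ₐ[k] B)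
    (hθ : ∀ t, θ (MvPowerSeries.X t) ∈ 𝓕.F 1) (hθ' : ∀ t, θ' (MvPowerSeries.X t) ∈ 𝓕.F 1) {m : ℕ}
    (hv : ∀ i, θ (mv k υ i) - θ' (mv k υ i) ∈ 𝓕.F m)
    (hw : ∀ u, θ (pv k α β u) - θ' (pv k α β u) ∈ 𝓕.F m) (g : PolyPower k α β υ) :
    θ g - θ' g ∈ 𝓕.F m :=
  hom_sub_mem 𝓕 θ θ' hθ hθ' _ (isClosed_filtration 𝓕 m) hv hw g

lemma derivation_eq_zero (θ : PolyPower k α β υ →ₐ[k] B)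
    (hθ : ∀ t, θ (MvPowerSeries.X t) ∈ 𝓕.F 1) (D : PolyPower k α β υ →+ B)
    (hD : ∀ a b, D (a * b) = θ a * D b + θ b * D a)
    (hk : ∀ r, D (algebraMap k _ r) = 0)
    (hv : ∀ i, D (mv k υ i) = 0) (hw : ∀ u, D (pv k α β u) = 0) (g : PolyPower k α β υ) :
    D g = 0 := by
  apply _root_.derivation_eq_zero 𝓕 θ.toRingHom hθ D hD
  · intro r
    induction r using MvPolynomial.induction_on with
    | C r =>
      have := hk r
      rwa [MvPowerSeries.algebraMap_apply] at this
    | add p q hp hq => rw [map_add, map_add, hp, hq, add_zero]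
    | mul_X p a hp =>
      rw [map_mul, hD, hp, mul_zero, add_zero]
      exact (congrArg _ (hv (Sum.inl a))).trans (mul_zero _)
  · rintro (b | u)
    · exact hv (Sum.inr b)
    · exact hw u

lemma algebraMap_powerSeries (r : k) :
    algebraMap k (PowerSeries B) r = PowerSeries.C (algebraMap k B r) := PowerSeries.algebraMap_apply

/-- The constant coefficient as an algebra homomorphism. -/
def coeffZero (k B : Type) [CommRing k] [CommRing B] [Algebra k B] : PowerSeries B →ₐ[k] B :=
  { PowerSeries.constantCoeff (R := B) with
    commutes' := fun r => by
      change PowerSeries.constantCoeff (algebraMap k (PowerSeries B) r) = _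
      rw [algebraMap_powerSeries, PowerSeries.constantCoeff_C] }

@[simp] lemma coeffZero_apply (p : PowerSeries B) : coeffZero k B p = PowerSeries.coeff 0 p := by
  rw [PowerSeries.coeff_zero_eq_constantCoeff]; rfl

lemma coeff_one_mul (p q : PowerSeries B) : PowerSeries.coeff 1 (p * q) =
    PowerSeries.coeff 0 p * PowerSeries.coeff 1 q +
      PowerSeries.coeff 0 q * PowerSeries.coeff 1 p := by
  rw [PowerSeries.coeff_mul, Finset.Nat.sum_antidiagonal_eq_sum_range_succ_mk,
    Finset.sum_range_succ, Finset.sum_range_succ]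
  simp [mul_comm]

lemma exists_pd (i : α ⊕ β) : ∃ D : PolyPower k α β υ →+ PolyPower k α β υ,
    (∀ a b, D (a * b) = a * D b + b * D a) ∧ (∀ r, D (algebraMap k _ r) = 0) ∧
    (D (mv k υ i) = 1 ∧ ∀ j, j ≠ i → D (mv k υ j) = 0) ∧ ∀ u, D (pv k α β u) = 0 := by
  classical
  set 𝓖 := orderFiltration (β ⊕ υ) (MvPolynomial α k)
  obtain ⟨θ, h1, h2, h3⟩ := exists_hom (k := k) (υ := υ) 𝓖.powerSeries
    (fun j : α ⊕ β => PowerSeries.C (mv k υ j) + if j = i then PowerSeries.X else 0)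
    (fun u => PowerSeries.C (pv k α β u))
    (by
      intro b
      apply CompleteFiltration.mem_powerSeries_one
      have : PowerSeries.coeff 0 (if Sum.inr b = i then
        (PowerSeries.X : PowerSeries (PolyPower k α β υ)) else 0) = 0 := by split_ifs <;> simp
      rw [map_add, this, add_zero, PowerSeries.coeff_zero_C]
      exact X_mem _)
    (by
      intro u
      apply CompleteFiltration.mem_powerSeries_one
      rw [PowerSeries.coeff_zero_C]
      exact X_mem _)
  have h0 : (coeffZero k _).comp θ = AlgHom.id k _ := by
    apply hom_ext 𝓖
    · intro t
      have := h3 t 0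
      simpa using this
    · intro t
      exact X_mem t
    · intro j
      have : PowerSeries.coeff 0 (if j = i then
        (PowerSeries.X : PowerSeries (PolyPower k α β υ)) else 0) = 0 := by split_ifs <;> simp
      rw [AlgHom.comp_apply, h1, coeffZero_apply, map_add, this, add_zero,
        PowerSeries.coeff_zero_C, AlgHom.id_apply]
    · intro u
      rw [AlgHom.comp_apply, h2, coeffZero_apply, PowerSeries.coeff_zero_C, AlgHom.id_apply]
  have h0' : ∀ a, PowerSeries.coeff 0 (θ a) = a := by
    intro a
    have := AlgHom.congr_fun h0 a
    rwa [AlgHom.comp_apply, coeffZero_apply, AlgHom.id_apply] at this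
  refine ⟨(PowerSeries.coeff 1).toAddMonoidHom.comp θ.toRingHom.toAddMonoidHom, ?_, ?_, ⟨?_, ?_⟩,
    ?_⟩
  · intro a b
    change PowerSeries.coeff 1 (θ (a * b)) =
      a * PowerSeries.coeff 1 (θ b) + b * PowerSeries.coeff 1 (θ a)
    rw [map_mul, coeff_one_mul, h0', h0']
  · intro r
    change PowerSeries.coeff 1 (θ (algebraMap k _ r)) = 0
    rw [AlgHom.commutes, algebraMap_powerSeries, PowerSeries.coeff_C, if_neg one_ne_zero]
  · change PowerSeries.coeff 1 (θ _) = 1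
    rw [h1, if_pos rfl, map_add, PowerSeries.coeff_C, if_neg one_ne_zero, PowerSeries.coeff_one_X,
      zero_add]
  · intro j hj
    change PowerSeries.coeff 1 (θ _) = 0
    rw [h1, if_neg hj, add_zero, PowerSeries.coeff_C, if_neg one_ne_zero]
  · intro j
    change PowerSeries.coeff 1 (θ _) = 0
    rw [h2, PowerSeries.coeff_C, if_neg one_ne_zero]

/-- The partial derivatives. -/
def pd (i : α ⊕ β) : PolyPower k α β υ →+ PolyPower k α β υ := (exists_pd i).choose

lemma pd_mul (i : α ⊕ β) (a b : PolyPower k α β υ) : pd i (a * b) = a * pd i b + b * pd i a :=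
  (exists_pd i).choose_spec.1 a b

lemma pd_algebraMap (i : α ⊕ β) (r : k) : pd i (algebraMap k (PolyPower k α β υ) r) = 0 :=
  (exists_pd i).choose_spec.2.1 r

lemma pd_mv_self (i : α ⊕ β) : pd i (mv k υ i) = 1 := (exists_pd i).choose_spec.2.2.1.1

lemma pd_mv_ne (i j : α ⊕ β) (h : j ≠ i) : pd i (mv k υ j) = 0 :=
  (exists_pd i).choose_spec.2.2.1.2 j h

lemma pd_pv (i : α ⊕ β) (u : υ) : pd i (pv k α β u) = 0 := (exists_pd i).choose_spec.2.2.2 u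

variable [Fintype α]

/-- The chain rule. -/
lemma derivation_eq_sum (θ : PolyPower k α β υ →ₐ[k] B)
    (hθ : ∀ t, θ (MvPowerSeries.X t) ∈ 𝓕.F 1) (D : PolyPower k α β υ →+ B)
    (hD : ∀ a b, D (a * b) = θ a * D b + θ b * D a)
    (hk : ∀ r, D (algebraMap k _ r) = 0) (hw : ∀ u, D (pv k α β u) = 0) (g : PolyPower k α β υ) :
    D g = ∑ i, θ (pd i g) * D (mv k υ i) := by
  let S : PolyPower k α β υ →+ B :=
    { toFun := fun g => ∑ i, θ (pd i g) * D (mv k υ i)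
      map_zero' := by simp
      map_add' := by
        intro x y
        simp only [map_add, add_mul, Finset.sum_add_distrib] }
  have hS : ∀ g, S g = ∑ i, θ (pd i g) * D (mv k υ i) := fun _ => rfl
  have := derivation_eq_zero 𝓕 θ hθ (D - S) ?_ ?_ ?_ ?_ g
  · rw [AddMonoidHom.sub_apply, sub_eq_zero] at this
    rw [this, hS]
  · intro a b
    rw [AddMonoidHom.sub_apply, AddMonoidHom.sub_apply, AddMonoidHom.sub_apply, hD, hS, hS, hS]
    have : ∀ i, θ (pd i (a * b)) * D (mv k υ i) = θ a * (θ (pd i b) * D (mv k υ i)) +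
        θ b * (θ (pd i a) * D (mv k υ i)) := by
      intro i
      rw [pd_mul, map_add, map_mul, map_mul]; ring
    simp_rw [this, Finset.sum_add_distrib, ← Finset.mul_sum]
    ring
  · intro r
    rw [AddMonoidHom.sub_apply, hk, hS]
    simp [pd_algebraMap]
  · intro j
    rw [AddMonoidHom.sub_apply, hS, Finset.sum_eq_single j, pd_mv_self, map_one, one_mul, sub_self]
    · intro i _ hij
      rw [pd_mv_ne i j hij.symm, map_zero, zero_mul]
    · simp
  · intro u
    rw [AddMonoidHom.sub_apply, hw, hS]
    simp [pd_pv]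

end Basic

section Eval

variable {B : Type} [CommRing B] (𝓕 : CompleteFiltration B)

/-- Evaluation of a power series in one variable. -/
lemma exists_specialization {s : B} (hs : s ∈ 𝓕.F 1) :
    ∃ ev : PowerSeries B →+* B, (∀ b, ev (PowerSeries.C b) = b) ∧ ev PowerSeries.X = s ∧
      ∀ n, ∀ p ∈ 𝓕.coeffs.F n, ev p ∈ 𝓕.F n := by
  obtain ⟨ev, h1, h2⟩ := exists_eval (τ := Unit) 𝓕 (RingHom.id B) (fun _ => s) (fun _ => hs)
  have h1' : ∀ b, ev (PowerSeries.C b) = b := h1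
  have h2' : ev PowerSeries.X = s := h2 ()
  refine ⟨ev, h1', h2', ?_⟩
  have key : ∀ m n, ∀ p ∈ 𝓕.coeffs.F n, m ≤ n → ev p ∈ 𝓕.F m := by
    intro m
    induction m with
    | zero => intro n p _ _; exact 𝓕.mem_zero _
    | succ m ih =>
      intro n p hp hmn
      have := PowerSeries.eq_X_mul_shift_add_const p
      rw [this, map_add, map_mul, h1', h2']
      apply Ideal.add_mem
      · apply 𝓕.mul_succ hs
        apply ih n _ _ (by omega)
        intro i
        rw [PowerSeries.coeff_mk]
        exact hp _
      · apply 𝓕.anti hmn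
        have := hp 0
        rwa [PowerSeries.coeff_zero_eq_constantCoeff] at this
  intro n p hp
  exact key n n p hp le_rfl

end Eval

section Taylor

variable {k : Type} [CommRing k] {α β υ : Type} [Fintype α] [Fintype β] [Fintype υ]
  {B : Type} [CommRing B] [Algebra k B] (𝓕 : CompleteFiltration B)

/-- Second order Taylor expansion. -/
lemma taylor (θ : PolyPower k α β υ →ₐ[k] B)
    (hθ : ∀ t, θ (MvPowerSeries.X t) ∈ 𝓕.F 1) {s : B} (hs : s ∈ 𝓕.F 1) (f : PolyPower k α β υ) :
    ∃ Q : (α ⊕ β → B) → B,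
      (∀ σ, ∀ θ' : PolyPower k α β υ →ₐ[k] B, (∀ i, θ' (mv k υ i) = θ (mv k υ i) + s * σ i) →
        (∀ u, θ' (pv k α β u) = θ (pv k α β u)) →
        θ' f = θ f + s * (∑ i, θ (pd i f) * σ i) + s ^ 2 * Q σ) ∧
      ∀ n σ σ', (∀ i, σ i - σ' i ∈ 𝓕.F n) → Q σ - Q σ' ∈ 𝓕.F n := by
  obtain ⟨ev, e1, e2, e3⟩ := exists_specialization 𝓕 hs
  have hmem : ∀ σ : α ⊕ β → B, ∀ b, PowerSeries.C (θ (mv k υ (Sum.inr b))) +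
      PowerSeries.X * PowerSeries.C (σ (Sum.inr b)) ∈ 𝓕.powerSeries.F 1 := by
    intro σ b
    apply CompleteFiltration.mem_powerSeries_one
    rw [map_add, PowerSeries.coeff_zero_C, PowerSeries.coeff_zero_X_mul, add_zero]
    exact hθ _
  have hmem' : ∀ u, PowerSeries.C (θ (pv k α β u)) ∈ 𝓕.powerSeries.F 1 := by
    intro u
    apply CompleteFiltration.mem_powerSeries_one
    rw [PowerSeries.coeff_zero_C]
    exact hθ _
  choose Θ h1 h2 h3 using fun σ : α ⊕ β → B => exists_hom (k := k) (υ := υ) 𝓕.powerSeries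
    (fun i => PowerSeries.C (θ (mv k υ i)) + PowerSeries.X * PowerSeries.C (σ i))
    (fun u => PowerSeries.C (θ (pv k α β u))) (hmem σ) hmem'
  have h0 : ∀ σ a, PowerSeries.coeff 0 (Θ σ a) = θ a := by
    intro σ a
    have : (coeffZero k _).comp (Θ σ) = θ := by
      apply hom_ext 𝓕
      · intro t
        have := h3 σ t 0
        simpa using this
      · exact hθ
      · intro i
        rw [AlgHom.comp_apply, h1, coeffZero_apply, map_add, PowerSeries.coeff_zero_X_mul,
          add_zero, PowerSeries.coeff_zero_C]
      · intro u
        rw [AlgHom.comp_apply, h2, coeffZero_apply, PowerSeries.coeff_zero_C]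
    rw [← this, AlgHom.comp_apply, coeffZero_apply]
  have hc1 : ∀ σ a, PowerSeries.coeff 1 (Θ σ a) = ∑ i, θ (pd i a) * σ i := by
    intro σ a
    have := derivation_eq_sum 𝓕 θ hθ
      ((PowerSeries.coeff 1).toAddMonoidHom.comp (Θ σ).toRingHom.toAddMonoidHom) ?_ ?_ ?_ a
    · refine this.trans ?_
      apply Finset.sum_congr rfl
      intro i _
      congr 1
      change PowerSeries.coeff 1 (Θ σ _) = _
      rw [h1, map_add, PowerSeries.coeff_C, if_neg one_ne_zero, zero_add,
        PowerSeries.coeff_succ_X_mul, PowerSeries.coeff_zero_C]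
    · intro a b
      change PowerSeries.coeff 1 (Θ σ (a * b)) =
        θ a * PowerSeries.coeff 1 (Θ σ b) + θ b * PowerSeries.coeff 1 (Θ σ a)
      rw [map_mul, coeff_one_mul, h0, h0]
    · intro r
      change PowerSeries.coeff 1 (Θ σ (algebraMap k _ r)) = 0
      rw [AlgHom.commutes, algebraMap_powerSeries, PowerSeries.coeff_C, if_neg one_ne_zero]
    · intro u
      change PowerSeries.coeff 1 (Θ σ _) = 0
      rw [h2, PowerSeries.coeff_C, if_neg one_ne_zero]
  have hshift : ∀ p : PowerSeries B, ev p = PowerSeries.coeff 0 p + s * PowerSeries.coeff 1 p +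
      s ^ 2 * ev (PowerSeries.mk fun n => PowerSeries.coeff (n + 2) p) := by
    intro p
    have a1 := congrArg ev (PowerSeries.eq_X_mul_shift_add_const p)
    have a2 := congrArg ev (PowerSeries.eq_X_mul_shift_add_const
      (PowerSeries.mk fun n => PowerSeries.coeff (n + 1) p))
    rw [map_add, map_mul, e1, e2] at a1 a2
    simp only [PowerSeries.coeff_mk, ← PowerSeries.coeff_zero_eq_constantCoeff_apply,
      zero_add] at a1 a2
    rw [a1, a2]
    simp only [add_assoc, one_add_one_eq_two]
    ring
  refine ⟨fun σ => ev (PowerSeries.mk fun n => PowerSeries.coeff (n + 2) (Θ σ f)), ?_, ?_⟩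
  · intro σ θ' hv hw
    have : ∀ a, θ' a = ev (Θ σ a) := by
      let ev' : PowerSeries B →ₐ[k] B := { ev with commutes' := fun r => (congrArg ev (algebraMap_powerSeries r)).trans (e1 _) }
      have hev' : ∀ p, ev' p = ev p := fun _ => rfl
      have : θ' = ev'.comp (Θ σ) := by
        have hθ' : ∀ t, θ' (MvPowerSeries.X t) ∈ 𝓕.F 1 := by
          rintro (b | u)
          · have := hv (Sum.inr b)
            change θ' (MvPowerSeries.X (Sum.inl b)) =
              θ (MvPowerSeries.X (Sum.inl b)) + s * σ (Sum.inr b) at this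
            rw [this]
            exact Ideal.add_mem _ (hθ _) (Ideal.mul_mem_right _ _ hs)
          · have := hw u
            change θ' (MvPowerSeries.X (Sum.inr u)) = θ (MvPowerSeries.X (Sum.inr u)) at this
            rw [this]
            exact hθ _
        have hv' : ∀ i, θ' (mv k υ i) = (ev'.comp (Θ σ)) (mv k υ i) := by
          intro i
          rw [hv, AlgHom.comp_apply, h1, hev', map_add, map_mul, e1, e1, e2]
        have hw' : ∀ u, θ' (pv k α β u) = (ev'.comp (Θ σ)) (pv k α β u) := by
          intro i
          rw [hw, AlgHom.comp_apply, h2, hev', e1]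
        apply hom_ext 𝓕 _ _ hθ' _ hv' hw'
        rintro (b | u)
        · exact (hv' (Sum.inr b)) ▸ hθ' (Sum.inl b)
        · exact (hw' u) ▸ hθ' (Sum.inr u)
      intro a
      rw [this, AlgHom.comp_apply, hev']
    rw [this, hshift, h0, hc1]
  · intro n σ σ' h
    rw [← map_sub]
    apply e3
    have := hom_sub_mem 𝓕.powerSeries (Θ σ) (Θ σ') (h3 σ) (h3 σ') _ (isClosed_coeffs 𝓕 n)
      (by
        intro i
        rw [h1, h1, add_sub_add_left_eq_sub, ← mul_sub, ← map_sub]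
        apply Ideal.mul_mem_left
        intro j
        rw [PowerSeries.coeff_C]
        split_ifs
        · exact h i
        · exact Ideal.zero_mem _)
      (by
        intro u
        rw [h2, h2, sub_self]
        exact Ideal.zero_mem _) f
    intro i
    have h2 := this (i + 2)
    simpa using h2

end Taylor

end PolyPower

namespace PolyPower

section Tougeron

variable {k : Type} [CommRing k] {α β υ : Type} [Fintype α] [Fintype β] [Fintype υ]
  {B : Type} [CommRing B] [Algebra k B] (𝓕 : CompleteFiltration B)
  {ι : Type} [Fintype ι] [DecidableEq ι]

/-- The contraction governing Newton's method. -/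
lemma exists_newton_contraction (θ : PolyPower k α β υ →ₐ[k] B)
    (hθ : ∀ t, θ (MvPowerSeries.X t) ∈ 𝓕.F 1) (f : ι → PolyPower k α β υ) {t W : B}
    (ht : t ∈ 𝓕.F 1) (N : α ⊕ β → ι → B) (F ρ : ι → B) (H ρ' : ι → ι → B)
    (hf : ∀ i, θ (f i) = t * W ^ 2 * F i + ρ i)
    (hJ : ∀ i l, ∑ v, θ (pd v (f i)) * N v l = W * ((if i = l then 1 else 0) + H i l) + ρ' i l)
    (hH : ∀ i l, H i l ∈ 𝓕.F 1) :
    ∃ T : (ι → B) → ι → B,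
      (∀ n z z', (∀ i, z i - z' i ∈ 𝓕.F n) → ∀ i, T z i - T z' i ∈ 𝓕.F (n + 1)) ∧
      ∀ ζ, ∀ θ' : PolyPower k α β υ →ₐ[k] B,
        (∀ v, θ' (mv k υ v) = θ (mv k υ v) + t * W * ∑ l, N v l * ζ l) →
        (∀ u, θ' (pv k α β u) = θ (pv k α β u)) →
        ∀ i, θ' (f i) = ρ i + t * W * (∑ l, ρ' i l * ζ l) + t * W ^ 2 * (ζ i - T ζ i) := by
  have hs : t * W ∈ 𝓕.F 1 := Ideal.mul_mem_right _ _ ht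
  choose Q hQ1 hQ2 using fun i => taylor 𝓕 θ hθ hs (f i)
  refine ⟨fun ζ i => - F i - ∑ l, H i l * ζ l - t * Q i (fun v => ∑ l, N v l * ζ l), ?_, ?_⟩
  · intro n z z' h i
    have h1 : ∀ l, H i l * (z l - z' l) ∈ 𝓕.F (n + 1) := fun l => 𝓕.mul_succ (hH i l) (h l)
    have h2 : ∑ l, H i l * (z l - z' l) ∈ 𝓕.F (n + 1) := Ideal.sum_mem _ (fun l _ => h1 l)
    have h3 := hQ2 i n (fun v => ∑ l, N v l * z l) (fun v => ∑ l, N v l * z' l) (by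
      intro v
      rw [← Finset.sum_sub_distrib]
      apply Ideal.sum_mem
      intro l _
      rw [← mul_sub]
      exact Ideal.mul_mem_left _ _ (h l))
    have h4 := Ideal.neg_mem_iff _ |>.mpr (Ideal.add_mem _ h2 (𝓕.mul_succ ht h3))
    convert h4 using 1
    simp_rw [mul_sub, Finset.sum_sub_distrib]
    ring
  · intro ζ θ' hv hw i
    rw [hQ1 i (fun v => ∑ l, N v l * ζ l) θ' hv hw, hf]
    have : ∑ v, θ (pd v (f i)) * ∑ l, N v l * ζ l =
        W * ζ i + W * (∑ l, H i l * ζ l) + ∑ l, ρ' i l * ζ l := by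
      simp_rw [Finset.mul_sum]
      rw [Finset.sum_comm]
      have h1 : ∀ l, ∑ v, θ (pd v (f i)) * (N v l * ζ l) =
          (if i = l then W * ζ l else 0) + W * (H i l * ζ l) + ρ' i l * ζ l := by
        intro l
        simp_rw [← mul_assoc]
        rw [← Finset.sum_mul, hJ]
        split_ifs <;> ring
      simp_rw [h1, Finset.sum_add_distrib]
      simp
    rw [this]
    ring

/-- Newton's method. -/
lemma exists_newton (θ : PolyPower k α β υ →ₐ[k] B)
    (hθ : ∀ t, θ (MvPowerSeries.X t) ∈ 𝓕.F 1) (f : ι → PolyPower k α β υ) {t W : B}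
    (ht : t ∈ 𝓕.F 1) (N : α ⊕ β → ι → B) (F ρ : ι → B) (H ρ' : ι → ι → B)
    (hf : ∀ i, θ (f i) = t * W ^ 2 * F i + ρ i)
    (hJ : ∀ i l, ∑ v, θ (pd v (f i)) * N v l = W * ((if i = l then 1 else 0) + H i l) + ρ' i l)
    (hH : ∀ i l, H i l ∈ 𝓕.F 1) :
    ∃ ζ : ι → B, ∀ θ' : PolyPower k α β υ →ₐ[k] B,
        (∀ v, θ' (mv k υ v) = θ (mv k υ v) + t * W * ∑ l, N v l * ζ l) →
        (∀ u, θ' (pv k α β u) = θ (pv k α β u)) →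
        ∀ i, θ' (f i) = ρ i + t * W * (∑ l, ρ' i l * ζ l) := by
  obtain ⟨T, h1, h2⟩ := exists_newton_contraction 𝓕 θ hθ f ht N F ρ H ρ' hf hJ hH
  obtain ⟨ζ, hζ⟩ := 𝓕.exists_fixedPoint T h1
  refine ⟨ζ, fun θ' hv hw i => ?_⟩
  rw [h2 ζ θ' hv hw i, hζ]
  ring

lemma newton_unique [IsDomain B] (θ : PolyPower k α β υ →ₐ[k] B)
    (hθ : ∀ t, θ (MvPowerSeries.X t) ∈ 𝓕.F 1) (f : ι → PolyPower k α β υ) {t W : B}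
    (ht : t ∈ 𝓕.F 1) (ht0 : t ≠ 0) (hW0 : W ≠ 0) (N : α ⊕ β → ι → B) (F : ι → B) (H : ι → ι → B)
    (hf : ∀ i, θ (f i) = t * W ^ 2 * F i)
    (hJ : ∀ i l, ∑ v, θ (pd v (f i)) * N v l = W * ((if i = l then 1 else 0) + H i l))
    (hH : ∀ i l, H i l ∈ 𝓕.F 1) {ζ₁ ζ₂ : ι → B} (θ₁ θ₂ : PolyPower k α β υ →ₐ[k] B)
    (hv₁ : ∀ v, θ₁ (mv k υ v) = θ (mv k υ v) + t * W * ∑ l, N v l * ζ₁ l)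
    (hw₁ : ∀ u, θ₁ (pv k α β u) = θ (pv k α β u)) (hz₁ : ∀ i, θ₁ (f i) = 0)
    (hv₂ : ∀ v, θ₂ (mv k υ v) = θ (mv k υ v) + t * W * ∑ l, N v l * ζ₂ l)
    (hw₂ : ∀ u, θ₂ (pv k α β u) = θ (pv k α β u)) (hz₂ : ∀ i, θ₂ (f i) = 0) : ζ₁ = ζ₂ := by
  obtain ⟨T, h1, h2⟩ := exists_newton_contraction 𝓕 θ hθ f ht N F 0 H 0 (by simpa using hf)
    (by simpa using hJ) hH
  have key : ∀ ζ, ∀ θ' : PolyPower k α β υ →ₐ[k] B,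
      (∀ v, θ' (mv k υ v) = θ (mv k υ v) + t * W * ∑ l, N v l * ζ l) →
      (∀ u, θ' (pv k α β u) = θ (pv k α β u)) → (∀ i, θ' (f i) = 0) → T ζ = ζ := by
    intro ζ θ' hv hw hz
    funext i
    have := h2 ζ θ' hv hw i
    rw [hz] at this
    simp only [Pi.zero_apply, zero_mul, Finset.sum_const_zero, mul_zero, zero_add] at this
    have h3 := (mul_eq_zero.mp this.symm).resolve_left (mul_ne_zero ht0 (pow_ne_zero _ hW0))
    exact (sub_eq_zero.mp h3).symm
  exact 𝓕.fixedPoint_unique T h1 (key _ _ hv₁ hw₁ hz₁) (key _ _ hv₂ hw₂ hz₂)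

end Tougeron

end PolyPower

section Weierstrass

variable {B : Type} [CommRing B] (𝓕 : CompleteFiltration B)

namespace PowerSeries

/-- Forgetting the first `M` coefficients. -/
def shift (M : ℕ) (p : PowerSeries B) : PowerSeries B := PowerSeries.mk fun i => coeff (i + M) p

@[simp] lemma coeff_shift (M i : ℕ) (p : PowerSeries B) :
    coeff i (shift M p) = coeff (i + M) p := coeff_mk _ _

lemma coeff_sub_X_pow_mul_shift (M : ℕ) (p : PowerSeries B) {i : ℕ} (hi : M ≤ i) :
    coeff i (p - X ^ M * shift M p) = 0 := by
  obtain ⟨j, rfl⟩ := Nat.exists_eq_add_of_le' hi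
  rw [map_sub, coeff_X_pow_mul, coeff_shift, sub_self]

lemma shift_X_pow_mul_add (M : ℕ) (p r : PowerSeries B) (hr : ∀ i, M ≤ i → coeff i r = 0) :
    shift M (X ^ M * p + r) = p := by
  ext i
  rw [coeff_shift, map_add, coeff_X_pow_mul, hr _ (Nat.le_add_left _ _), add_zero]

lemma eq_sum_of_coeff_eq_zero {M : ℕ} {r : PowerSeries B} (hr : ∀ i, M ≤ i → coeff i r = 0) :
    r = ∑ i : Fin M, C (coeff (i : ℕ) r) * X ^ (i : ℕ) := by
  ext j
  rw [map_sum]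
  simp_rw [coeff_C_mul, coeff_X_pow]
  by_cases hj : j < M
  · rw [Finset.sum_eq_single (⟨j, hj⟩ : Fin M)]
    · simp
    · intro i _ hi
      rw [if_neg, mul_zero]
      intro h
      exact hi (Fin.ext h.symm)
    · simp
  · rw [hr j (not_lt.mp hj)]
    symm
    apply Finset.sum_eq_zero
    intro i _
    rw [if_neg (by omega), mul_zero]

lemma coeff_sum_C_mul_X_pow {M : ℕ} (c : Fin M → B) {j : ℕ} (hj : M ≤ j) :
    coeff j (∑ i : Fin M, C (c i) * X ^ (i : ℕ)) = 0 := by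
  rw [map_sum]
  apply Finset.sum_eq_zero
  intro i _
  rw [coeff_C_mul, coeff_X_pow, if_neg (by omega), mul_zero]

lemma sum_C_mul_X_pow_mem_coeffs {M : ℕ} (c : Fin M → B) (n : ℕ) (hc : ∀ i, c i ∈ 𝓕.F n) :
    ∑ i : Fin M, C (c i) * X ^ (i : ℕ) ∈ 𝓕.coeffs.F n := by
  apply Ideal.sum_mem
  intro i _
  apply Ideal.mul_mem_right
  intro j
  rw [coeff_C]
  split_ifs
  exacts [hc i, Ideal.zero_mem _]

/-- Division by a series congruent to a power of the variable. -/
lemma exists_division (M : ℕ) {b : PowerSeries B} (hb : b ∈ 𝓕.coeffs.F 1) (g : PowerSeries B) :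
    ∃ q r, g = (X ^ M + b) * q + r ∧ ∀ i, M ≤ i → coeff i r = 0 := by
  obtain ⟨z, hz⟩ := 𝓕.coeffs.exists_fixedPoint (ι := Unit)
    (fun z _ => shift M (g - b * z ())) (by
    intro n z z' h i j
    have := 𝓕.coeffs.mul_succ hb (h ()) (j + M)
    rw [← Ideal.neg_mem_iff] at this
    convert this using 1
    rw [map_sub, coeff_shift, coeff_shift, ← map_sub, ← map_neg]
    congr 1
    ring)
  have hz' := congrFun hz ()
  refine ⟨z (), (g - b * z ()) - X ^ M * shift M (g - b * z ()), ?_,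
    fun i hi => coeff_sub_X_pow_mul_shift _ _ hi⟩
  rw [hz']
  ring

lemma division_unique (M : ℕ) {b : PowerSeries B} (hb : b ∈ 𝓕.coeffs.F 1) {q r : PowerSeries B}
    (h : (X ^ M + b) * q + r = 0) (hr : ∀ i, M ≤ i → coeff i r = 0) : q = 0 ∧ r = 0 := by
  have hq : q = 0 := by
    have h1 : shift M (X ^ M * q + r) = q := shift_X_pow_mul_add M q r hr
    have h2 : X ^ M * q + r = - (b * q) := by linear_combination h
    rw [h2] at h1
    apply 𝓕.coeffs.sep
    intro n
    induction n with
    | zero => exact 𝓕.coeffs.mem_zero _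
    | succ n ih =>
      rw [← h1]
      intro j
      have := 𝓕.coeffs.mul_succ hb ih (j + M)
      rw [coeff_shift, map_neg]
      exact (Ideal.neg_mem_iff _).mpr this
  refine ⟨hq, ?_⟩
  rw [hq, mul_zero, zero_add] at h
  exact h

/-- Weierstrass preparation. -/
lemma exists_preparation (d : ℕ) {δ : PowerSeries B} (hlow : ∀ i < d, coeff i δ ∈ 𝓕.F 1)
    (hd : IsUnit (coeff d δ)) :
    ∃ (e : PowerSeries B) (w : Fin d → B), (∀ i, w i ∈ 𝓕.F 1) ∧
      δ * e = X ^ d + ∑ i : Fin d, C (w i) * X ^ (i : ℕ) := by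
  have hu : IsUnit (shift d δ) := by
    rw [PowerSeries.isUnit_iff_constantCoeff, ← coeff_zero_eq_constantCoeff_apply, coeff_shift,
      zero_add]
    exact hd
  obtain ⟨u, hu⟩ := hu.exists_right_inv
  set b := δ - X ^ d * shift d δ with hb
  have hbF : b ∈ 𝓕.coeffs.F 1 := by
    intro i
    by_cases hi : d ≤ i
    · rw [hb, coeff_sub_X_pow_mul_shift _ _ hi]
      exact Ideal.zero_mem _
    · rw [hb, map_sub, coeff_X_pow_mul', if_neg hi, sub_zero]
      exact hlow i (not_le.mp hi)
  have hbu : b * u ∈ 𝓕.coeffs.F 1 := Ideal.mul_mem_right _ _ hbF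
  have hδu : δ * u = X ^ d + b * u := by
    rw [hb]
    linear_combination X ^ d * hu
  obtain ⟨q, r, h1, h2⟩ := exists_division 𝓕 d hbu (X ^ d)
  have hq : q - 1 ∈ 𝓕.coeffs.F 1 := by
    have h3 := shift_X_pow_mul_add d (q - 1) r h2
    have h4 : X ^ d * (q - 1) + r = -(b * u * q) := by linear_combination -h1
    rw [h4] at h3
    rw [← h3]
    intro j
    rw [coeff_shift, map_neg, Ideal.neg_mem_iff]
    exact Ideal.mul_mem_right q _ hbu (j + d)
  have hr : r ∈ 𝓕.coeffs.F 1 := by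
    have : r = -(X ^ d * (q - 1) + b * u * q) := by linear_combination -h1
    rw [this, Ideal.neg_mem_iff]
    exact Ideal.add_mem _ (Ideal.mul_mem_left _ _ hq) (Ideal.mul_mem_right _ _ hbu)
  refine ⟨u * q, fun i => - coeff (i : ℕ) r, fun i => (Ideal.neg_mem_iff _).mpr (hr i), ?_⟩
  have : ∑ i : Fin d, C (- coeff (i : ℕ) r) * X ^ (i : ℕ) = - r := by
    conv_rhs => rw [eq_sum_of_coeff_eq_zero h2]
    simp
  rw [this, ← mul_assoc, hδu]
  linear_combination -h1

end PowerSeries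

end Weierstrass

/-- Linearly independent rows over a domain have a right inverse up to a nonzero scalar. -/
lemma exists_rightInverse_of_linearIndependent {R V ι : Type} [CommRing R] [IsDomain R] [Fintype V]
    [Fintype ι] [DecidableEq ι] {m : ι → V → R} (hm : LinearIndependent R m) :
    ∃ (N : V → ι → R) (δ : R), δ ≠ 0 ∧ ∀ i l, ∑ v, m i v * N v l = if i = l then δ else 0 := by
  classical
  let L := FractionRing R
  let e : (V → R) →ₗ[R] (V → L) := LinearMap.funLeft R L id ∘ₗ
    (LinearMap.compLeft (Algebra.linearMap R L) V)
  have he : ∀ x v, e x v = algebraMap R L (x v) := fun _ _ => rfl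
  have h1 : LinearIndependent R (e ∘ m) := by
    apply hm.map'
    rw [LinearMap.ker_eq_bot]
    intro x y hxy
    funext v
    have := congrFun hxy v
    rw [he, he] at this
    exact IsFractionRing.injective R L this
  rw [LinearIndependent.iff_fractionRing R L] at h1
  obtain ⟨g, hg⟩ := LinearMap.exists_leftInverse_of_injective (Fintype.linearCombination L (e ∘ m))
    (LinearMap.ker_eq_bot.mpr h1.fintypeLinearCombination_injective)
  obtain ⟨b, hb⟩ := IsLocalization.exist_integer_multiples_of_finite (nonZeroDivisors R)
    (fun p : V × ι => g (Pi.single p.1 1) p.2)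
  choose N hN using hb
  refine ⟨fun v l => N (v, l), b, nonZeroDivisors.ne_zero b.2, ?_⟩
  intro i l
  apply IsFractionRing.injective R L
  rw [map_sum]
  have h2 : ∀ v, algebraMap R L (m i v * N (v, l)) =
      algebraMap R L b * (algebraMap R L (m i v) * g (Pi.single v 1) l) := by
    intro v
    rw [map_mul, hN, Algebra.smul_def]
    ring
  simp_rw [h2, ← Finset.mul_sum]
  have h3 : g (e (m i)) = Pi.single i 1 := by
    have := LinearMap.congr_fun hg (Pi.single i 1)
    rw [LinearMap.comp_apply, Fintype.linearCombination_apply, LinearMap.id_apply] at this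
    rw [← this]
    congr 1
    rw [Finset.sum_eq_single i]
    · simp
    · intro j _ hj
      simp [hj]
    · simp
  have h4 : ∑ v, algebraMap R L (m i v) * g (Pi.single v 1) l = g (e (m i)) l := by
    have : e (m i) = ∑ v, algebraMap R L (m i v) • (Pi.single v (1 : L) : V → L) := by
      funext w
      rw [he, Finset.sum_apply, Finset.sum_eq_single w]
      · simp
      · intro v _ hv
        simp [hv.symm]
      · simp
    rw [this, map_sum, Finset.sum_apply]
    apply Finset.sum_congr rfl
    intro v _
    rw [map_smul, Pi.smul_apply, smul_eq_mul]
  rw [h4, h3]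
  by_cases hil : i = l
  · subst hil; simp
  · simp [hil]

namespace PolyPower

section Selection

variable {k : Type} [CommRing k] {α β υ : Type} [Fintype α] [Fintype β] [Fintype υ]

/-- A Jacobian criterion system for a point `φ`. -/
structure Selection {E : Type} [CommRing E] [Algebra k E] (φ : PolyPower k α β υ →ₐ[k] E)
    (ι : Type) [Fintype ι] [DecidableEq ι] where
  /-- The equations. -/
  f : ι → PolyPower k α β υ
  f_mem : ∀ i, φ (f i) = 0
  /-- A multiple of a right inverse of the Jacobian matrix. -/
  N : α ⊕ β → ι → E
  /-- The multiplier. -/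
  δ : E
  δ_ne : δ ≠ 0
  right_inv : ∀ i l, ∑ v, φ (pd v (f i)) * N v l = if i = l then δ else 0
  spans : ∀ g, φ g = 0 → ∃ (e₀ : PolyPower k α β υ) (e : ι → PolyPower k α β υ), φ e₀ ≠ 0 ∧
    ∀ v, φ (e₀ * pd v g - ∑ i, e i * pd v (f i)) = 0

lemma exists_selection {E : Type} [CommRing E] [IsDomain E] [Algebra k E]
    (φ : PolyPower k α β υ →ₐ[k] E) :
    ∃ (ι : Type) (_ : Fintype ι) (_ : DecidableEq ι), Nonempty (Selection φ ι) := by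
  classical
  let grad : RingHom.ker φ → α ⊕ β → φ.range := fun g v => ⟨φ (pd v g.1), ⟨_, rfl⟩⟩
  obtain ⟨s, hs1, hs2⟩ := exists_maximal_linearIndepOn φ.range grad
  have hli : LinearIndependent φ.range (fun i : s => grad i) := hs1
  have : Finite s := hli.finite
  have := Fintype.ofFinite s
  obtain ⟨N, δ, hδ, hN⟩ := exists_rightInverse_of_linearIndependent hli
  refine ⟨s, inferInstance, inferInstance, ⟨⟨fun i => i.1.1, fun i => i.1.2,
    fun v l => N v l, δ, ?_, ?_, ?_⟩⟩⟩
  · intro h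
    exact hδ (Subtype.ext h)
  · intro i l
    have := congrArg (Subtype.val) (hN i l)
    rw [AddSubmonoidClass.coe_finsetSum] at this
    refine Eq.trans ?_ (this.trans ?_)
    · rfl
    · split_ifs <;> rfl
  · intro g hg
    have h1 : ∃ a : φ.range, a ≠ 0 ∧ a • grad ⟨g, hg⟩ ∈ Submodule.span φ.range (Set.image grad s) := by
      by_cases h : (⟨g, hg⟩ : RingHom.ker φ) ∈ s
      · exact ⟨1, one_ne_zero, by
          rw [one_smul]; exact Submodule.subset_span (Set.mem_image_of_mem _ h)⟩
      · exact hs2 _ h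
    obtain ⟨⟨_, e₀, rfl⟩, ha, h2⟩ := h1
    rw [Set.image_eq_range, Submodule.mem_span_range_iff_exists_fun] at h2
    obtain ⟨c, hc⟩ := h2
    choose e he using fun i => (c i).2
    refine ⟨e₀, e, fun h => ha (Subtype.ext h), ?_⟩
    intro v
    have h3 := congrArg Subtype.val (congrFun hc v)
    rw [Finset.sum_apply, AddSubmonoidClass.coe_finsetSum] at h3
    rw [map_sub, map_sum, sub_eq_zero]
    refine Eq.trans ?_ (h3.symm.trans ?_)
    · rw [map_mul]; rfl
    · apply Finset.sum_congr rfl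
      intro i _
      rw [map_mul]
      change (c i).1 * _ = _
      rw [← he i]
      rfl

/-- Transport of a selection along an injective homomorphism. -/
def Selection.map {E E' : Type} [CommRing E] [Algebra k E] [CommRing E'] [Algebra k E']
    {φ : PolyPower k α β υ →ₐ[k] E}
    {ι : Type} [Fintype ι] [DecidableEq ι] (s : Selection φ ι) (e : E →+* E')
    (he : Function.Injective e) (φ' : PolyPower k α β υ →ₐ[k] E') (hφ : ∀ a, φ' a = e (φ a)) :
    Selection φ' ι where
  f := s.f
  f_mem i := by rw [hφ, s.f_mem, map_zero]
  N v l := e (s.N v l)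
  δ := e s.δ
  δ_ne := by rw [Ne, map_eq_zero_iff e he]; exact s.δ_ne
  right_inv i l := by
    have := congrArg e (s.right_inv i l)
    rw [map_sum] at this
    simp_rw [hφ, ← map_mul]
    rw [this]
    split_ifs <;> simp
  spans g hg := by
    rw [hφ, map_eq_zero_iff e he] at hg
    obtain ⟨e₀, e', h1, h2⟩ := s.spans g hg
    refine ⟨e₀, e', ?_, fun v => ?_⟩
    · rw [hφ, Ne, map_eq_zero_iff e he]; exact h1
    · rw [hφ, h2, map_zero]

/-- An arc through a point along which the selected equations vanish lies on the whole variety. -/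
lemma Selection.arc_eq_zero {R : Type} [CommRing R] [IsDomain R] [CharZero R]
    [Algebra k R]
    (𝓕 : CompleteFiltration R) {φ : PolyPower k α β υ →ₐ[k] R} {ι : Type} [Fintype ι]
    [DecidableEq ι] (s : Selection φ ι) (ψ : PolyPower k α β υ →ₐ[k] PowerSeries R)
    (hψ : ∀ t, ψ (MvPowerSeries.X t) ∈ 𝓕.powerSeries.F 1)
    (h0 : ∀ g, PowerSeries.coeff 0 (ψ g) = φ g) (hf : ∀ i, ψ (s.f i) = 0)
    (hw : ∀ u, ∃ c, ψ (pv k α β u) = PowerSeries.C c) {g : PolyPower k α β υ} (hg : φ g = 0) :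
    ψ g = 0 := by
  let D : PolyPower k α β υ →+ PowerSeries R :=
    (PowerSeries.derivative R).toLinearMap.toAddMonoidHom.comp ψ.toRingHom.toAddMonoidHom
  have hD : ∀ a, D a = PowerSeries.derivative R (ψ a) := fun _ => rfl
  have chain : ∀ a, D a = ∑ v, ψ (pd v a) * D (mv k υ v) := by
    apply derivation_eq_sum 𝓕.powerSeries ψ hψ
    · intro a b
      rw [hD, map_mul, Derivation.leibniz, hD, hD, smul_eq_mul, smul_eq_mul]
    · intro r
      rw [hD, AlgHom.commutes, algebraMap_powerSeries, PowerSeries.derivative_C]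
    · intro u
      obtain ⟨c, hc⟩ := hw u
      rw [hD, hc, PowerSeries.derivative_C]
  have key : ∀ n, ∀ g, φ g = 0 → PowerSeries.X ^ n ∣ ψ g := by
    intro n
    induction n with
    | zero => intro g _; rw [pow_zero]; exact one_dvd _
    | succ n ih =>
      intro g hg
      obtain ⟨e₀, e, h1, h2⟩ := s.spans g hg
      have h3 : ψ e₀ * D g = ∑ v, ψ (e₀ * pd v g - ∑ i, e i * pd v (s.f i)) * D (mv k υ v) := by
        have h4 : ∑ i, ψ (e i) * D (s.f i) = 0 := by
          apply Finset.sum_eq_zero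
          intro i _
          rw [hD, hf, map_zero, mul_zero]
        rw [← sub_zero (ψ e₀ * D g), ← h4]
        conv_lhs => rw [chain g]
        simp_rw [chain (s.f _), Finset.mul_sum]
        rw [Finset.sum_comm, ← Finset.sum_sub_distrib]
        apply Finset.sum_congr rfl
        intro v _
        rw [map_sub, map_mul, map_sum, sub_mul, Finset.sum_mul]
        simp_rw [map_mul, mul_assoc]
      have h5 : PowerSeries.X ^ n ∣ ψ e₀ * D g := by
        rw [h3]
        apply Finset.dvd_sum
        intro v _
        exact Dvd.dvd.mul_right (ih _ (h2 v)) _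
      have h6 : PowerSeries.X ^ n ∣ D g := by
        refine PowerSeries.X_prime.pow_dvd_of_dvd_mul_left n ?_ h5
        rw [PowerSeries.X_dvd_iff, ← PowerSeries.coeff_zero_eq_constantCoeff_apply, h0]
        exact h1
      rw [PowerSeries.X_pow_dvd_iff] at h6 ⊢
      intro m hm
      rcases m with _ | m
      · rw [h0, hg]
      · have := h6 m (by omega)
        rw [hD, PowerSeries.coeff_derivative] at this
        have hm0 : (m : R) + 1 ≠ 0 := by exact_mod_cast Nat.succ_ne_zero m
        exact (mul_eq_zero.mp this).resolve_right hm0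
  ext n
  have := key (n + 1) g hg
  rw [PowerSeries.X_pow_dvd_iff] at this
  rw [this n (Nat.lt_succ_self n), map_zero]

end Selection

end PolyPower

namespace PolyPower

lemma forall_X_mem {k : Type} [CommRing k] {α β υ : Type} {E : Type} [CommRing E] [Algebra k E]
    (𝓔 : CompleteFiltration E) (θ : PolyPower k α β υ →ₐ[k] E) (h1 : ∀ b, θ (mv k υ (Sum.inr b)) ∈ 𝓔.F 1)
    (h2 : ∀ u, θ (pv k α β u) ∈ 𝓔.F 1) (t : β ⊕ υ) : θ (MvPowerSeries.X t) ∈ 𝓔.F 1 := by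
  rcases t with b | u
  · exact h1 b
  · exact h2 u

variable {k : Type} [CommRing k] {α β υ : Type} [Fintype α] [Fintype β] [Fintype υ]
  {E : Type} [CommRing E] [Algebra k E] (𝓔 : CompleteFiltration E)
  {ι : Type} [Fintype ι] [DecidableEq ι]

/-- First order Taylor expansion. -/
lemma exists_taylor_one (θ θ' : PolyPower k α β υ →ₐ[k] E)
    (hθ : ∀ t, θ (MvPowerSeries.X t) ∈ 𝓔.F 1) {D : E} (hD : D ∈ 𝓔.F 1) (σ : α ⊕ β → E)
    (hv : ∀ v, θ' (mv k υ v) = θ (mv k υ v) + D * σ v)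
    (hw : ∀ u, θ' (pv k α β u) = θ (pv k α β u)) (f : PolyPower k α β υ) :
    ∃ c, θ' f = θ f + D * c := by
  obtain ⟨Q, hQ, -⟩ := taylor 𝓔 θ hθ hD f
  refine ⟨(∑ i, θ (pd i f) * σ i) + D * Q σ, ?_⟩
  rw [hQ σ θ' hv hw]
  ring

/-- The Jacobian system at a point close to a zero. -/
lemma exists_system_of_congr {φ : PolyPower k α β υ →ₐ[k] E} (s : Selection φ ι)
    (hφ : ∀ t, φ (MvPowerSeries.X t) ∈ 𝓔.F 1) {W D : E} (hD : D ∈ 𝓔.F 1)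
    {N N' n : α ⊕ β → ι → E} {q : α ⊕ β → E}
    (hN : ∀ i l, ∑ v, φ (pd v (s.f i)) * N v l = if i = l then W else 0)
    (hN' : ∀ v l, N v l = D * n v l + N' v l)
    (θ : PolyPower k α β υ →ₐ[k] E) (hv : ∀ v, φ (mv k υ v) = D * q v + θ (mv k υ v))
    (hw : ∀ u, θ (pv k α β u) = φ (pv k α β u)) :
    ∃ (F : ι → E) (H : ι → ι → E), (∀ i, θ (s.f i) = D * F i) ∧
      ∀ i l, ∑ v, θ (pd v (s.f i)) * N' v l = (if i = l then W else 0) + D * H i l := by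
  choose c hc using exists_taylor_one 𝓔 φ θ hφ hD (fun v => - q v)
    (fun v => by rw [hv]; ring) hw
  refine ⟨fun i => c (s.f i), fun i l => ∑ v, (c (pd v (s.f i)) * N' v l -
    φ (pd v (s.f i)) * n v l), ?_, ?_⟩
  · intro i
    rw [hc, s.f_mem, zero_add]
  · intro i l
    rw [← hN, Finset.mul_sum, ← Finset.sum_add_distrib]
    apply Finset.sum_congr rfl
    intro v _
    rw [hc, hN']
    ring

/-- A zero of the selected equations in Newton position with respect to `φ` lies on the variety
of `φ`. -/
lemma Selection.eq_zero_of_newton [IsDomain E] [CharZero E]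
    {φ : PolyPower k α β υ →ₐ[k] E} (s : Selection φ ι)
    (hφ : ∀ t, φ (MvPowerSeries.X t) ∈ 𝓔.F 1) {W t : E} (ht : t ∈ 𝓔.F 1) (ht0 : t ≠ 0)
    (hW0 : W ≠ 0) {N N' n : α ⊕ β → ι → E} {q V : α ⊕ β → E}
    (hN : ∀ i l, ∑ v, φ (pd v (s.f i)) * N v l = if i = l then W else 0)
    (hN' : ∀ v l, N v l = t * W ^ 2 * n v l + N' v l)
    (hV : ∀ v, φ (mv k υ v) = t * W ^ 2 * q v + V v)
    (χ : PolyPower k α β υ →ₐ[k] E) {ζ : ι → E}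
    (hχ : ∀ v, χ (mv k υ v) = V v + t * W * ∑ l, N' v l * ζ l)
    (hχw : ∀ u, χ (pv k α β u) = φ (pv k α β u)) (hχf : ∀ i, χ (s.f i) = 0)
    {g : PolyPower k α β υ} (hg : φ g = 0) : χ g = 0 := by
  have hD : t * W ^ 2 ∈ 𝓔.F 1 := Ideal.mul_mem_right _ _ ht
  have hφv : ∀ b, φ (mv k υ (Sum.inr b)) ∈ 𝓔.F 1 := fun b => hφ (Sum.inl b)
  have hφw : ∀ u, φ (pv k α β u) ∈ 𝓔.F 1 := fun u => hφ (Sum.inr u)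
  have hVb : ∀ b, V (Sum.inr b) ∈ 𝓔.F 1 := by
    intro b
    have : V (Sum.inr b) = φ (mv k υ (Sum.inr b)) - t * W ^ 2 * q (Sum.inr b) := by
      rw [hV]; ring
    rw [this]
    exact Ideal.sub_mem _ (hφv b) (Ideal.mul_mem_right _ _ hD)
  have hχ1 : ∀ x, χ (MvPowerSeries.X x) ∈ 𝓔.F 1 := by
    apply forall_X_mem
    · intro b
      rw [hχ, mul_assoc]
      exact Ideal.add_mem _ (hVb b) (Ideal.mul_mem_right _ _ ht)
    · intro u
      rw [hχw]
      exact hφw u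
  obtain ⟨θ, hθv, hθw, hθ⟩ := exists_hom (k := k) (υ := υ) 𝓔 V (fun u => φ (pv k α β u)) hVb hφw
  obtain ⟨F, H, hF, hH⟩ := exists_system_of_congr 𝓔 s hφ hD hN hN' θ
    (fun v => by rw [hθv, hV]) hθw
  -- the arc
  let 𝓢 := 𝓔.powerSeries
  let C : E →+* PowerSeries E := PowerSeries.C
  have hCF : ∀ {x : E}, x ∈ 𝓔.F 1 → C x ∈ 𝓢.F 1 := by
    intro x hx
    apply CompleteFiltration.mem_powerSeries_one
    change PowerSeries.coeff 0 (PowerSeries.C x) ∈ _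
    rwa [PowerSeries.coeff_zero_C]
  let z : PowerSeries E := PowerSeries.X
  have hz : z ∈ 𝓢.F 1 := 𝓔.X_mem_powerSeries
  obtain ⟨Cφ, hCv, hCw, hCφ⟩ := exists_hom (k := k) (υ := υ) 𝓢 (fun v => C (φ (mv k υ v)))
    (fun u => C (φ (pv k α β u))) (fun b => hCF (hφv b)) (fun u => hCF (hφw u))
  let Calg : E →ₐ[k] PowerSeries E :=
    { C with commutes' := fun r => (algebraMap_powerSeries r).symm }
  have hCφC : ∀ a, Cφ a = C (φ a) := by
    have : Cφ = Calg.comp φ := hom_ext 𝓢 _ _ hCφ (fun x => hCF (hφ x)) hCv hCw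
    intro a
    rw [this]
    rfl
  obtain ⟨θs, hsv, hsw, hs⟩ := exists_hom (k := k) (υ := υ) 𝓢
    (fun v => C (φ (mv k υ v)) + z * C W ^ 2 * (- C (q v)))
    (fun u => C (φ (pv k α β u)))
    (fun b => Ideal.add_mem _ (hCF (hφv b))
      (Ideal.mul_mem_right _ _ (Ideal.mul_mem_right _ _ hz)))
    (fun u => hCF (hφw u))
  choose c hc using exists_taylor_one 𝓢 Cφ θs hCφ (D := z * C W ^ 2)
    (Ideal.mul_mem_right _ _ hz) (fun v => - C (q v))
    (fun v => by rw [hsv, hCv]) (fun u => by rw [hsw, hCw])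
  obtain ⟨ζs, hζs⟩ := exists_newton 𝓢 θs hs s.f (t := z) (W := C W) hz
    (fun v l => C (N' v l)) (fun i => c (s.f i)) 0
    (fun i l => C t * (- C W * ∑ v, C (φ (pd v (s.f i))) * C (n v l)) +
      z * (C W * ∑ v, c (pd v (s.f i)) * C (N' v l))) 0
    (by
      intro i
      rw [hc, hCφC, s.f_mem, map_zero, Pi.zero_apply]
      ring)
    (by
      intro i l
      have h1 : ∀ v, θs (pd v (s.f i)) * C (N' v l) =
          C (φ (pd v (s.f i)) * N v l) - C t * C W ^ 2 * (C (φ (pd v (s.f i))) * C (n v l)) +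
            z * C W ^ 2 * (c (pd v (s.f i)) * C (N' v l)) := by
        intro v
        rw [hc, hCφC, hN', map_mul, map_add, map_mul, map_mul, map_pow]
        ring
      simp_rw [h1]
      rw [Finset.sum_add_distrib, Finset.sum_sub_distrib, ← Finset.mul_sum, ← Finset.mul_sum,
        ← map_sum C, hN, Pi.zero_apply, Pi.zero_apply]
      split_ifs
      · ring
      · rw [map_zero]; ring)
    (by
      intro i l
      exact Ideal.add_mem _ (Ideal.mul_mem_right _ _ (hCF ht)) (Ideal.mul_mem_right _ _ hz))
  obtain ⟨ψ, hψv, hψw, hψ⟩ := exists_hom (k := k) (υ := υ) 𝓢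
    (fun v => θs (mv k υ v) + z * C W * ∑ l, C (N' v l) * ζs l)
    (fun u => θs (pv k α β u))
    (fun b => Ideal.add_mem _ (hs (Sum.inl b))
      (Ideal.mul_mem_right _ _ (Ideal.mul_mem_right _ _ hz)))
    (fun u => hs (Sum.inr u))
  have hψf : ∀ i, ψ (s.f i) = 0 := by
    intro i
    rw [hζs ψ hψv hψw i]
    simp
  have hψ0 : ∀ a, PowerSeries.coeff 0 (ψ a) = φ a := by
    have : (coeffZero k E).comp ψ = φ := by
      apply hom_ext 𝓔 _ _ _ hφ
      · intro v
        rw [AlgHom.comp_apply, hψv, hsv, coeffZero_apply, map_add, map_add, mul_assoc z,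
          mul_assoc z]
        change PowerSeries.coeff 0 (PowerSeries.C _) + PowerSeries.coeff 0 (PowerSeries.X * _) +
          PowerSeries.coeff 0 (PowerSeries.X * _) = _
        rw [PowerSeries.coeff_zero_X_mul, PowerSeries.coeff_zero_X_mul, PowerSeries.coeff_zero_C,
          add_zero, add_zero]
      · intro u
        rw [AlgHom.comp_apply, hψw, hsw, coeffZero_apply]
        change PowerSeries.coeff 0 (PowerSeries.C _) = _
        rw [PowerSeries.coeff_zero_C]
      · intro x
        have := hψ x 0
        simpa using this
    intro a
    rw [← this, AlgHom.comp_apply, coeffZero_apply]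
  have hψg := s.arc_eq_zero 𝓔 ψ hψ hψ0 hψf (fun u => ⟨φ (pv k α β u), by rw [hψw, hsw]⟩) hg
  -- specialization of the arc
  obtain ⟨ev, ev1, ev2, -⟩ := exists_specialization 𝓔 ht
  let ev' : PowerSeries E →ₐ[k] E :=
    { ev with commutes' := fun r => (congrArg ev (algebraMap_powerSeries r)).trans (ev1 _) }
  have hev' : ∀ p, ev' p = ev p := fun _ => rfl
  have ev1' : ∀ b, ev (C b) = b := ev1
  have ev2' : ev z = t := ev2
  have hpv : ∀ v, (ev'.comp ψ) (mv k υ v) = θ (mv k υ v) + t * W * ∑ l, N' v l * ev (ζs l) := by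
    intro v
    rw [AlgHom.comp_apply, hψv, hsv, hev', hθv, map_add, map_add, map_mul, map_mul, map_mul,
      map_mul, map_neg, map_pow, ev1', ev1', ev1', ev2', map_sum]
    simp_rw [map_mul, ev1']
    rw [hV]
    ring
  have hpw : ∀ u, (ev'.comp ψ) (pv k α β u) = φ (pv k α β u) := by
    intro u
    rw [AlgHom.comp_apply, hψw, hsw, hev', ev1']
  have heq : ζ = fun l => ev (ζs l) := by
    refine newton_unique 𝓔 θ hθ s.f ht ht0 hW0 N' F (fun i l => t * (W * H i l))
      hF ?_ ?_ χ (ev'.comp ψ) ?_ ?_ hχf hpv ?_ ?_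
    · intro i l
      rw [hH]
      split_ifs <;> ring
    · intro i l
      exact Ideal.mul_mem_right _ _ ht
    · intro v
      rw [hχ, hθv]
    · intro u
      rw [hχw, hθw]
    · intro u
      rw [hpw, hθw]
    · intro i
      rw [AlgHom.comp_apply, hψf, map_zero]
  have : χ = ev'.comp ψ := by
    have e1 : ∀ v, χ (mv k υ v) = (ev'.comp ψ) (mv k υ v) := by
      intro v
      rw [hpv, hχ, hθv, heq]
    have e2 : ∀ u, χ (pv k α β u) = (ev'.comp ψ) (pv k α β u) := by
      intro u
      rw [hpw, hχw]
    apply hom_ext 𝓔 _ _ hχ1 _ e1 e2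
    apply forall_X_mem
    · intro b
      rw [← e1]; exact hχ1 (Sum.inl b)
    · intro u
      rw [← e2]; exact hχ1 (Sum.inr u)
  rw [this, AlgHom.comp_apply, hψg, map_zero]

end PolyPower

namespace PowerSeries

lemma exists_X_pow_mul_sq_eq {B : Type} [CommRing B] (𝓕 : CompleteFiltration B) (d κ : ℕ)
    (w : Fin d → B) (hw : ∀ i, w i ∈ 𝓕.F 1) :
    ∃ b ∈ 𝓕.coeffs.F 1, (X : PowerSeries B) ^ κ * (X ^ d + ∑ i : Fin d, C (w i) * X ^ (i : ℕ)) ^ 2 =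
      X ^ (2 * d + κ) + b := by
  have h := sum_C_mul_X_pow_mem_coeffs 𝓕 w 1 hw
  set b := ∑ i : Fin d, C (w i) * X ^ (i : ℕ)
  refine ⟨b * (X ^ κ * (2 * X ^ d + b)), Ideal.mul_mem_right _ _ h, ?_⟩
  ring

lemma X_pow_mem_powerSeries {B : Type} [CommRing B] (𝓕 : CompleteFiltration B) (n : ℕ) :
    (X : PowerSeries B) ^ n ∈ 𝓕.powerSeries.F n :=
  𝓕.powerSeries.pow_mem 𝓕.X_mem_powerSeries n

end PowerSeries

lemma mvPowerSeries_ringHom_ext {τ R B : Type} [CommRing R] [CommRing B] [Fintype τ]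
    (𝓕 : CompleteFiltration B) (θ θ' : MvPowerSeries τ R →+* B)
    (hθ : ∀ t, θ (MvPowerSeries.X t) ∈ 𝓕.F 1)
    (hC : ∀ r, θ (MvPowerSeries.C r) = θ' (MvPowerSeries.C r))
    (hX : ∀ t, θ (MvPowerSeries.X t) = θ' (MvPowerSeries.X t)) : θ = θ' := by
  ext g
  have := ringHom_sub_mem 𝓕 θ θ' hθ (fun t => hX t ▸ hθ t) ⊥ ?_ (fun i => by simp [hC])
    (fun i => by simp [hX]) g
  · simpa [sub_eq_zero] using this
  · intro b hb
    rw [Ideal.mem_bot]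
    apply 𝓕.sep
    intro n
    obtain ⟨c, hc, h⟩ := hb n
    rw [Ideal.mem_bot, sub_eq_zero] at h
    rwa [h]

namespace PolyPower

/-- The approximation property for points in power series over `K` in `γ` variables: a point can
be approximated by points on the same variety with coefficients in a finitely generated algebra. -/
def Approx (k K : Type) [Field k] [Field K] [Algebra k K] (γ : ℕ) : Prop :=
  ∀ (α β υ : Type) (_ : Fintype α) (_ : Fintype β) (_ : Fintype υ)
    (φ : PolyPower k α β υ →ₐ[k] MvPowerSeries (Fin γ) K),
    (∀ t, φ (MvPowerSeries.X t) ∈ (orderFiltration (Fin γ) K).F 1) →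
    (∀ u, ∃ m : MvPowerSeries (Fin γ) k, φ (pv k α β u) = MvPowerSeries.map (algebraMap k K) m) →
    ∀ κ : ℕ, ∃ S : Subalgebra k K, S.FG ∧ ∃ ψ : PolyPower k α β υ →ₐ[k] MvPowerSeries (Fin γ) K,
      (∀ u, ψ (pv k α β u) = φ (pv k α β u)) ∧
      (∀ a e, MvPowerSeries.coeff e (ψ a) ∈ S) ∧
      (∀ a, ψ a - φ a ∈ (orderFiltration (Fin γ) K).F κ) ∧ ∀ a, φ a = 0 → ψ a = 0

instance (γ : ℕ) (K : Type) [Field K] : IsDomain (PowerSeries (MvPowerSeries (Fin γ) K)) :=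
  NoZeroDivisors.to_isDomain _

instance (γ : ℕ) (K : Type) [Field K] [CharZero K] :
    CharZero (PowerSeries (MvPowerSeries (Fin γ) K)) :=
  charZero_of_injective_ringHom (f := (PowerSeries.C (R := MvPowerSeries (Fin γ) K)).comp
    (MvPowerSeries.C (σ := Fin γ) (R := K)))
    (fun _ _ h => MvPowerSeries.C_injective (PowerSeries.C_injective h))

lemma exists_fixedVars (k K : Type) [Field k] [Field K] [Algebra k K] (γ : ℕ) (α β : Type)
    [Fintype β] :
    ∃ ε : MvPowerSeries (Fin γ) k →+* PolyPower k α β (Fin γ),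
      (∀ m, m ∈ (orderFiltration (Fin γ) k).F 1 →
        ε m ∈ (orderFiltration (β ⊕ Fin γ) (MvPolynomial α k)).F 1) ∧
      ∀ c : PolyPower k α β (Fin γ) →ₐ[k] MvPowerSeries (Fin γ) K,
        (∀ j, c (pv k α β j) = MvPowerSeries.X j) →
        c.toRingHom.comp ε = MvPowerSeries.map (algebraMap k K) := by
  obtain ⟨ε, h1, h2⟩ := exists_eval (τ := Fin γ) (orderFiltration (β ⊕ Fin γ) (MvPolynomial α k))
    (algebraMap k (PolyPower k α β (Fin γ))) (fun j => pv k α β j)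
    (fun j => X_mem_orderFiltration _)
  refine ⟨ε, ?_, ?_⟩
  · intro m hm
    apply ringHom_mem_filtration _ ε _ hm
    intro t
    rw [h2]
    exact X_mem_orderFiltration _
  · intro c hc
    apply mvPowerSeries_ringHom_ext (orderFiltration (Fin γ) K)
    · intro t
      rw [RingHom.comp_apply, h2]
      change c _ ∈ _
      rw [hc]
      exact X_mem_orderFiltration _
    · intro r
      rw [RingHom.comp_apply, h1]
      change c _ = _
      rw [AlgHom.commutes, MvPowerSeries.algebraMap_apply, MvPowerSeries.map_C]
    · intro t
      rw [RingHom.comp_apply, h2]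
      change c _ = _
      rw [hc, MvPowerSeries.map_X]

/-- The inductive step of the approximation theorem in the regular case. -/
lemma Approx.step {k K : Type} [Field k] [Field K] [Algebra k K] [CharZero K] {γ : ℕ}
    (hA : Approx k K γ) {α β υ : Type} [Fintype α] [Fintype β] [Fintype υ]
    (φ : PolyPower k α β υ →ₐ[k] PowerSeries (MvPowerSeries (Fin γ) K))
    (hφ : ∀ t, φ (MvPowerSeries.X t) ∈ (orderFiltration (Fin γ) K).powerSeries.F 1)
    (hυ : ∀ u, ∃ m : PowerSeries (MvPowerSeries (Fin γ) k),
      PowerSeries.coeff 0 m ∈ (orderFiltration (Fin γ) k).F 1 ∧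
      φ (pv k α β u) = PowerSeries.map (MvPowerSeries.map (algebraMap k K)) m)
    {ι : Type} [Fintype ι] [DecidableEq ι] (s : Selection φ ι) (d : ℕ)
    (hlow : ∀ i < d, PowerSeries.coeff i s.δ ∈ (orderFiltration (Fin γ) K).F 1)
    (hd : PowerSeries.coeff d s.δ ∉ (orderFiltration (Fin γ) K).F 1) {κ : ℕ} (hκ : 1 ≤ κ) :
    ∃ S : Subalgebra k K, S.FG ∧
      ∃ ψ : PolyPower k α β υ →ₐ[k] PowerSeries (MvPowerSeries (Fin γ) K),
        (∀ a i e, MvPowerSeries.coeff e (PowerSeries.coeff i (ψ a)) ∈ S) ∧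
        (∀ u, ψ (pv k α β u) = φ (pv k α β u)) ∧
        (∀ a, ψ a - φ a ∈ (orderFiltration (Fin γ) K).powerSeries.F κ) ∧
        ∀ a, φ a = 0 → ψ a = 0 := by
  set 𝓡 := orderFiltration (Fin γ) K with h𝓡
  set 𝓔 := 𝓡.powerSeries with h𝓔
  -- Weierstrass data
  have hdu : IsUnit (PowerSeries.coeff d s.δ) := by
    rw [MvPowerSeries.isUnit_iff_constantCoeff, isUnit_iff_ne_zero]
    rwa [h𝓡, mem_orderFiltration_one] at hd
  obtain ⟨e, w, hw, hW⟩ := PowerSeries.exists_preparation 𝓡 d hlow hdu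
  obtain ⟨bD, hbD, hD⟩ := PowerSeries.exists_X_pow_mul_sq_eq 𝓡 d κ w hw
  set W := PowerSeries.X ^ d + ∑ i : Fin d, PowerSeries.C (w i) * PowerSeries.X ^ (i : ℕ) with hWdef
  have hW0 : W ≠ 0 := by
    rintro h0
    have := congrArg (PowerSeries.coeff d) h0
    rw [hWdef, map_add, PowerSeries.coeff_X_pow_self,
      PowerSeries.coeff_sum_C_mul_X_pow w le_rfl] at this
    simp at this
  set M := 2 * d + κ with hM
  let t : PowerSeries (MvPowerSeries (Fin γ) K) := PowerSeries.X ^ κ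
  have ht : t ∈ 𝓔.F 1 := 𝓔.anti hκ (PowerSeries.X_pow_mem_powerSeries 𝓡 κ)
  have ht0 : t ≠ 0 := pow_ne_zero _ PowerSeries.X_ne_zero
  have htW : t * W ^ 2 = PowerSeries.X ^ M + bD := hD
  have htW1 : t * W ^ 2 ∈ 𝓔.F 1 := Ideal.mul_mem_right _ _ ht
  let N : α ⊕ β → ι → PowerSeries (MvPowerSeries (Fin γ) K) := fun v l => s.N v l * e
  have hN : ∀ i l, ∑ v, φ (pd v (s.f i)) * N v l = if i = l then W else 0 := by
    intro i l
    simp_rw [N, ← mul_assoc]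
    rw [← Finset.sum_mul, s.right_inv, ← hW]
    split_ifs
    · rfl
    · rw [zero_mul]
  choose q V hV hVdeg using fun v => PowerSeries.exists_division 𝓡 M hbD (φ (mv k υ v))
  choose n N' hN' hN'deg using fun v l => PowerSeries.exists_division 𝓡 M hbD (N v l)
  simp_rw [← htW] at hV hN'
  have hVb : ∀ b, PowerSeries.coeff 0 (V (Sum.inr b)) ∈ 𝓡.F 1 := by
    intro b
    have h1 := Ideal.sub_mem _ (hφ (Sum.inl b)) (Ideal.mul_mem_right (q (Sum.inr b)) _ htW1)
    have h2 : V (Sum.inr b) = φ (MvPowerSeries.X (Sum.inl b)) - t * W ^ 2 * q (Sum.inr b) := by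
      have : φ (MvPowerSeries.X (Sum.inl b)) = φ (mv k υ (Sum.inr b)) := rfl
      rw [this, hV]; ring
    rw [h2]
    exact h1 0
  -- the universal ring
  let α' := ((α ⊕ β) × Fin M) ⊕ ((α ⊕ β) × ι × Fin M)
  let β' := β ⊕ Fin d
  let A' := PolyPower k α' β' (Fin γ)
  let 𝓐 : CompleteFiltration A' := orderFiltration (β' ⊕ Fin γ) (MvPolynomial α' k)
  let 𝓑 := 𝓐.powerSeries
  let x : α' → A' := fun a => mv k (Fin γ) (Sum.inl a)
  let y : β' → A' := fun b => mv k (Fin γ) (Sum.inr b)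
  have hy : ∀ b, y b ∈ 𝓐.F 1 := fun b => X_mem_orderFiltration _
  let cv : α' ⊕ β' → MvPowerSeries (Fin γ) K :=
    Sum.elim (Sum.elim (fun p => PowerSeries.coeff (p.2 : ℕ) (V p.1))
      (fun p => PowerSeries.coeff (p.2.2 : ℕ) (N' p.1 p.2.1)))
      (Sum.elim (fun b => PowerSeries.coeff 0 (V (Sum.inr b))) w)
  obtain ⟨c, hcv, hcw, hc⟩ := exists_hom (k := k) (υ := Fin γ) 𝓡 cv
    (fun j => MvPowerSeries.X j) (by rintro (b | i); exacts [hVb b, hw i])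
    (fun j => X_mem_orderFiltration _)
  let uV : α ⊕ β → Fin M → A' := fun v i => match v with
    | Sum.inl a => x (Sum.inl (Sum.inl a, i))
    | Sum.inr b => if (i : ℕ) = 0 then y (Sum.inl b) else x (Sum.inl (Sum.inr b, i))
  have hcuV : ∀ v i, c (uV v i) = PowerSeries.coeff (i : ℕ) (V v) := by
    rintro (a | b) i
    · exact hcv _
    · simp only [uV]
      split_ifs with h
      · refine (hcv _).trans ?_
        rw [h]; rfl
      · exact hcv _
  let uN : α ⊕ β → ι → Fin M → A' := fun v l i => x (Sum.inr (v, l, i))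
  have hcuN : ∀ v l i, c (uN v l i) = PowerSeries.coeff (i : ℕ) (N' v l) := fun v l i => hcv _
  let uw : Fin d → A' := fun i => y (Sum.inr i)
  have hcuw : ∀ i, c (uw i) = w i := fun i => hcv _
  let VB : α ⊕ β → PowerSeries A' := fun v =>
    ∑ i : Fin M, PowerSeries.C (uV v i) * PowerSeries.X ^ (i : ℕ)
  let NB : α ⊕ β → ι → PowerSeries A' := fun v l =>
    ∑ i : Fin M, PowerSeries.C (uN v l i) * PowerSeries.X ^ (i : ℕ)
  let WB : PowerSeries A' :=
    PowerSeries.X ^ d + ∑ i : Fin d, PowerSeries.C (uw i) * PowerSeries.X ^ (i : ℕ)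
  let tB : PowerSeries A' := PowerSeries.X ^ κ
  obtain ⟨bB, hbB, hDB⟩ := PowerSeries.exists_X_pow_mul_sq_eq 𝓐 d κ uw (fun i => hy _)
  have htWB : tB * WB ^ 2 = PowerSeries.X ^ M + bB := hDB
  have htB : tB ∈ 𝓑.F 1 := 𝓑.anti hκ (PowerSeries.X_pow_mem_powerSeries 𝓐 κ)
  let cc : PowerSeries A' →ₐ[k] PowerSeries (MvPowerSeries (Fin γ) K) := PowerSeries.mapAlgHom c
  have hcc : ∀ p i, PowerSeries.coeff i (cc p) = c (PowerSeries.coeff i p) :=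
    fun p i => PowerSeries.coeff_map _ _ _
  have hccX : cc PowerSeries.X = PowerSeries.X := PowerSeries.map_X _
  have hccC : ∀ r, cc (PowerSeries.C r) = PowerSeries.C (c r) := fun r => PowerSeries.map_C _ _
  have hccV : ∀ v, cc (VB v) = V v := by
    intro v
    rw [PowerSeries.eq_sum_of_coeff_eq_zero (hVdeg v), map_sum]
    simp_rw [map_mul, map_pow, hccX, hccC, hcuV]
  have hccN : ∀ v l, cc (NB v l) = N' v l := by
    intro v l
    rw [PowerSeries.eq_sum_of_coeff_eq_zero (hN'deg v l), map_sum]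
    simp_rw [map_mul, map_pow, hccX, hccC, hcuN]
  have hccW : cc WB = W := by
    rw [map_add, map_sum]
    simp_rw [map_mul, map_pow, hccX, hccC, hcuw]
    rfl
  have hcct : cc tB = t := by rw [map_pow, hccX]
  have hccD : cc (tB * WB ^ 2) = t * W ^ 2 := by rw [map_mul, hcct, map_pow cc WB 2, hccW]
  obtain ⟨ε, hε1, hε⟩ := exists_fixedVars k K γ α' β'
  choose ν hν1 hν using hυ
  let νB : υ → PowerSeries A' := fun u => PowerSeries.map ε (ν u)
  have hmapν : ∀ c' : A' →ₐ[k] MvPowerSeries (Fin γ) K, (∀ j, c' (pv k α' β' j) = MvPowerSeries.X j) →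
      ∀ u, PowerSeries.mapAlgHom c' (νB u) = φ (pv k α β u) := by
    intro c' hc' u
    rw [hν, ← hε c' hc']
    ext1 i
    change PowerSeries.coeff i (PowerSeries.map c'.toRingHom (PowerSeries.map ε (ν u))) = _
    rw [PowerSeries.coeff_map, PowerSeries.coeff_map, PowerSeries.coeff_map]
    rfl
  have hccν : ∀ u, cc (νB u) = φ (pv k α β u) := hmapν c hcw
  have hVB1 : ∀ b, VB (Sum.inr b) ∈ 𝓑.F 1 := by
    intro b
    apply Ideal.sum_mem
    intro i _
    rcases Nat.eq_zero_or_pos (i : ℕ) with hi | hi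
    · apply Ideal.mul_mem_right
      apply CompleteFiltration.mem_powerSeries_one
      rw [PowerSeries.coeff_zero_C]
      simp only [uV, if_pos hi]
      exact hy _
    · apply Ideal.mul_mem_left
      exact 𝓑.anti hi (PowerSeries.X_pow_mem_powerSeries 𝓐 i)
  have hνB1 : ∀ u, νB u ∈ 𝓑.F 1 := by
    intro u
    apply CompleteFiltration.mem_powerSeries_one
    rw [PowerSeries.coeff_map]
    exact hε1 _ (hν1 u)
  obtain ⟨Ψ₀, h0v, h0w, h0⟩ := exists_hom (k := k) (υ := υ) 𝓑 VB νB hVB1 hνB1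
  choose F ρ hF hρ using fun i => PowerSeries.exists_division 𝓐 M hbB (Ψ₀ (s.f i))
  choose H ρ' hH hρ' using fun i l => PowerSeries.exists_division 𝓐 M hbB
    ((∑ v, Ψ₀ (pd v (s.f i)) * NB v l) - if i = l then WB else 0)
  simp_rw [← htWB] at hF hH
  obtain ⟨ζ, hζ⟩ := exists_newton 𝓑 Ψ₀ h0 s.f (t := tB) (W := WB) htB NB F ρ
    (fun i l => tB * (WB * H i l)) ρ' hF
    (by
      intro i l
      have := hH i l
      rw [sub_eq_iff_eq_add] at this
      rw [this]
      split_ifs <;> ring)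
    (fun i l => Ideal.mul_mem_right _ _ htB)
  obtain ⟨Ψ, hΨv, hΨw, hΨ⟩ := exists_hom (k := k) (υ := υ) 𝓑
    (fun v => Ψ₀ (mv k υ v) + tB * WB * ∑ l, NB v l * ζ l) (fun u => Ψ₀ (pv k α β u))
    (fun b => Ideal.add_mem _ (h0 (Sum.inl b))
      (Ideal.mul_mem_right _ _ (Ideal.mul_mem_right _ _ htB)))
    (fun u => h0 (Sum.inr u))
  have hΨf := hζ Ψ hΨv hΨw
  -- the remainders vanish at `c`
  obtain ⟨F', H', hF', hH'⟩ := exists_system_of_congr 𝓔 s hφ htW1 hN hN' (cc.comp Ψ₀)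
    (q := q) (by intro v; rw [AlgHom.comp_apply, h0v, hccV, ← hV])
    (by intro u; rw [AlgHom.comp_apply, h0w, hccν])
  have hρ0 : ∀ i, cc (ρ i) = 0 := by
    intro i
    have h1 := hF' i
    rw [AlgHom.comp_apply, hF, map_add, map_mul, hccD, htW] at h1
    refine (PowerSeries.division_unique 𝓡 M hbD (q := cc (F i) - F' i) ?_ ?_).2
    · linear_combination h1
    · intro j hj
      rw [hcc, hρ i j hj, map_zero]
  have hρ'0 : ∀ i l, cc (ρ' i l) = 0 := by
    intro i l
    have h1 := hH' i l
    have h2 := congrArg cc (hH i l)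
    simp_rw [AlgHom.comp_apply, ← hccN, ← map_mul] at h1
    rw [← map_sum cc] at h1
    have h3 : cc (if i = l then WB else 0) = if i = l then W else 0 := by
      split_ifs
      exacts [hccW, map_zero _]
    rw [map_sub, map_add, map_mul, hccD, h3, htW] at h2
    rw [htW] at h1
    refine (PowerSeries.division_unique 𝓡 M hbD (q := cc (H i l) - H' i l) ?_ ?_).2
    · linear_combination h1 - h2
    · intro j hj
      rw [hcc, hρ' i l j hj, map_zero]
  have hχv : ∀ v, (cc.comp Ψ) (mv k υ v) = V v + t * W * ∑ l, N' v l * cc (ζ l) := by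
    intro v
    have h1 : cc (∑ l, NB v l * ζ l) = ∑ l, N' v l * cc (ζ l) := by
      rw [map_sum]
      simp_rw [map_mul, hccN]
    rw [AlgHom.comp_apply, hΨv, h0v, map_add, hccV, map_mul cc (tB * WB), map_mul cc tB, hcct,
      hccW, h1]
  have hker : ∀ a, φ a = 0 → cc (Ψ a) = 0 := by
    intro a ha
    refine s.eq_zero_of_newton 𝓔 hφ ht ht0 hW0 hN hN' hV (cc.comp Ψ) hχv ?_ ?_ ha
    · intro u
      rw [AlgHom.comp_apply, hΨw, h0w, hccν]
    · intro i
      rw [AlgHom.comp_apply, hΨf, map_add, hρ0, map_mul, map_sum]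
      simp_rw [map_mul, hρ'0]
      simp
  -- approximation of the coefficients
  obtain ⟨S, hS, c', hc'w, hc'S, hc'κ, hc'ker⟩ := hA α' β' (Fin γ) inferInstance inferInstance
    inferInstance c hc
    (fun j => ⟨MvPowerSeries.X j, by rw [hcw, MvPowerSeries.map_X]⟩) κ
  let cc' : PowerSeries A' →ₐ[k] PowerSeries (MvPowerSeries (Fin γ) K) := PowerSeries.mapAlgHom c'
  have hcc' : ∀ p i, PowerSeries.coeff i (cc' p) = c' (PowerSeries.coeff i p) :=
    fun p i => PowerSeries.coeff_map _ _ _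
  have hclose : ∀ p, cc' p - cc p ∈ 𝓔.F κ := by
    intro p
    apply 𝓡.coeffs_le_powerSeries
    intro i
    rw [map_sub, hcc', hcc]
    exact hc'κ _
  have hw' : ∀ u, (cc'.comp Ψ) (pv k α β u) = φ (pv k α β u) := by
    intro u
    rw [AlgHom.comp_apply, hΨw, h0w]
    exact hmapν c' (fun j => by rw [hc'w, hcw]) u
  have hv' : ∀ v, (cc'.comp Ψ) (mv k υ v) - φ (mv k υ v) ∈ 𝓔.F κ := by
    intro v
    have h1 := hclose (Ψ (mv k υ v))
    have h2 : cc (Ψ (mv k υ v)) - φ (mv k υ v) ∈ 𝓔.F κ := by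
      have h3 := hχv v
      rw [AlgHom.comp_apply] at h3
      have h4 : cc (Ψ (mv k υ v)) - φ (mv k υ v) =
          t * (W * (∑ l, N' v l * cc (ζ l)) - W ^ 2 * q v) := by
        rw [h3, hV]; ring
      rw [h4]
      exact Ideal.mul_mem_right _ _ (PowerSeries.X_pow_mem_powerSeries 𝓡 κ)
    have := Ideal.add_mem _ h1 h2
    rw [sub_add_sub_cancel] at this
    exact this
  have hadm : ∀ z, (cc'.comp Ψ) (MvPowerSeries.X z) ∈ 𝓔.F 1 := by
    apply forall_X_mem
    · intro b
      have := Ideal.add_mem _ (𝓔.anti hκ (hv' (Sum.inr b))) (hφ (Sum.inl b))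
      rw [show φ (MvPowerSeries.X (Sum.inl b)) = φ (mv k υ (Sum.inr b)) from rfl,
        sub_add_cancel] at this
      exact this
    · intro u
      rw [hw']
      exact hφ (Sum.inr u)
  refine ⟨S, hS, cc'.comp Ψ, ?_, hw', ?_, ?_⟩
  · intro a i e
    rw [AlgHom.comp_apply, hcc']
    exact hc'S _ _
  · exact hom_sub_mem_filtration 𝓔 _ _ hadm hφ hv'
      (fun u => by rw [hw', sub_self]; exact Ideal.zero_mem _)
  · intro a ha
    have h1 := hker a ha
    ext1 i
    rw [AlgHom.comp_apply, hcc', map_zero]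
    apply hc'ker
    rw [← hcc, h1, map_zero]

end PolyPower

namespace MvPowerSeries

section Shear

variable {R : Type} [CommRing R] {γ : ℕ}

lemma exists_shear (c : Fin γ → R) :
    ∃ θ : MvPowerSeries (Fin (γ + 1)) R →+* MvPowerSeries (Fin (γ + 1)) R,
      (∀ r, θ (C r) = C r) ∧
      ∀ i, θ (X i) = Fin.cons (α := fun _ => MvPowerSeries (Fin (γ + 1)) R) (X 0)
        (fun j : Fin γ => X j.succ + C (c j) * X 0) i :=
  exists_eval (orderFiltration (Fin (γ + 1)) R) C _ (by
    intro t
    refine Fin.cases ?_ (fun j => ?_) t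
    · exact X_mem_orderFiltration _
    · exact Ideal.add_mem _ (X_mem_orderFiltration _)
        (Ideal.mul_mem_left _ _ (X_mem_orderFiltration _)))

/-- The linear change of variables adding multiples of the first variable to the others. -/
def shear (c : Fin γ → R) : MvPowerSeries (Fin (γ + 1)) R →+* MvPowerSeries (Fin (γ + 1)) R :=
  (exists_shear c).choose

@[simp] lemma shear_C (c : Fin γ → R) (r : R) : shear c (C r) = C r :=
  (exists_shear c).choose_spec.1 r

@[simp] lemma shear_X_zero (c : Fin γ → R) : shear c (X 0) = X 0 :=
  (exists_shear c).choose_spec.2 0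

@[simp] lemma shear_X_succ (c : Fin γ → R) (j : Fin γ) :
    shear c (X j.succ) = X j.succ + C (c j) * X 0 :=
  (exists_shear c).choose_spec.2 j.succ

lemma shear_X_mem (c : Fin γ → R) (t : Fin (γ + 1)) :
    shear c (X t) ∈ (orderFiltration (Fin (γ + 1)) R).F 1 := by
  refine Fin.cases ?_ (fun j => ?_) t
  · rw [shear_X_zero]; exact X_mem_orderFiltration _
  · rw [shear_X_succ]
    exact Ideal.add_mem _ (X_mem_orderFiltration _)
        (Ideal.mul_mem_left _ _ (X_mem_orderFiltration _))

lemma shear_mem (c : Fin γ → R) {n : ℕ} {g : MvPowerSeries (Fin (γ + 1)) R}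
    (hg : g ∈ (orderFiltration (Fin (γ + 1)) R).F n) :
    shear c g ∈ (orderFiltration (Fin (γ + 1)) R).F n :=
  ringHom_mem_filtration _ (shear c) (shear_X_mem c) hg

lemma shear_comp {c c' : Fin γ → R} (h : c + c' = 0) (g : MvPowerSeries (Fin (γ + 1)) R) :
    shear c (shear c' g) = g := by
  have : (shear c).comp (shear c') = RingHom.id _ := by
    apply mvPowerSeries_ringHom_ext (orderFiltration (Fin (γ + 1)) R)
    · intro t
      exact shear_mem c (shear_X_mem c' t)
    · intro r; simp
    · intro t
      refine Fin.cases ?_ (fun j => ?_) t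
      · simp
      · have hj : C (c j) + C (c' j) = (0 : MvPowerSeries (Fin (γ + 1)) R) := by
          rw [← map_add, ← Pi.add_apply, h]; simp
        simp only [RingHom.comp_apply, shear_X_succ, map_add, map_mul, shear_C, shear_X_zero,
          RingHom.id_apply]
        linear_combination X 0 * hj
  exact RingHom.congr_fun this g

lemma map_mem_filtration {R' : Type} [CommRing R'] (f : R →+* R') {τ : Type} {n : ℕ}
    {g : MvPowerSeries τ R}
    (hg : g ∈ (orderFiltration τ R).F n) : map f g ∈ (orderFiltration τ R').F n := by
  intro e he
  rw [coeff_map, hg e he, map_zero]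

lemma map_shear {R' : Type} [CommRing R'] (f : R →+* R') (c : Fin γ → R)
    (g : MvPowerSeries (Fin (γ + 1)) R) :
    map f (shear c g) = shear (fun i => f (c i)) (map f g) := by
  have : (map f).comp (shear c) = (shear fun i => f (c i)).comp (map f) := by
    apply mvPowerSeries_ringHom_ext (orderFiltration (Fin (γ + 1)) R')
    · intro t
      exact map_mem_filtration f (shear_X_mem c t)
    · intro r; simp
    · intro t
      refine Fin.cases ?_ (fun j => ?_) t <;> simp
  exact RingHom.congr_fun this g

lemma coeff_shear_mem {k : Type} [CommRing k] [Algebra k R] (S : Subalgebra k R) (c : Fin γ → k)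
    {g : MvPowerSeries (Fin (γ + 1)) R} (hg : ∀ e, coeff e g ∈ S) (e : Fin (γ + 1) →₀ ℕ) :
    coeff e (shear (fun i => algebraMap k R (c i)) g) ∈ S := by
  let g' : MvPowerSeries (Fin (γ + 1)) S := fun e => ⟨coeff e g, hg e⟩
  have h1 : map S.val.toRingHom g' = g := by
    ext e
    rw [coeff_map]
    rfl
  have h2 := map_shear S.val.toRingHom (fun i => algebraMap k S (c i)) g'
  rw [h1] at h2
  have h3 : (fun i => S.val.toRingHom (algebraMap k S (c i))) = fun i => algebraMap k R (c i) := rfl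
  rw [h3] at h2
  rw [← h2, coeff_map]
  exact (coeff e (shear (fun i => algebraMap k S (c i)) g')).2

lemma finSuccEquiv_mem {n : ℕ} {g : MvPowerSeries (Fin (γ + 1)) R} :
    finSuccEquiv R γ g ∈ (orderFiltration (Fin γ) R).powerSeries.F n ↔
      g ∈ (orderFiltration (Fin (γ + 1)) R).F n := by
  have hdeg : ∀ (i : ℕ) (e : Fin γ →₀ ℕ), (e.cons i).degree = i + e.degree := by
    intro i e
    rw [Finsupp.degree_eq_sum, Finsupp.degree_eq_sum, Fin.sum_univ_succ]
    simp
  constructor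
  · intro h e he
    have := h (e 0) e.tail ?_
    · rwa [coeff_coeff_finSuccEquiv, Finsupp.cons_tail] at this
    · rw [← Finsupp.cons_tail e, hdeg] at he
      omega
  · intro h i e he
    rw [coeff_coeff_finSuccEquiv]
    apply h
    rw [hdeg]
    omega

lemma finSuccEquiv_map {R' : Type} [CommRing R'] (f : R →+* R')
    (g : MvPowerSeries (Fin (γ + 1)) R) :
    finSuccEquiv R' γ (map f g) = PowerSeries.map (map f) (finSuccEquiv R γ g) := by
  ext i e
  rw [coeff_coeff_finSuccEquiv, PowerSeries.coeff_map, coeff_map, coeff_map,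
    coeff_coeff_finSuccEquiv]

lemma coeff_eq_coeff_coeff (g : PowerSeries (MvPowerSeries (Fin γ) R)) (e : Fin (γ + 1) →₀ ℕ) :
    coeff e ((finSuccEquiv R γ).symm g) = coeff e.tail (PowerSeries.coeff (e 0) g) := by
  conv_rhs => rw [← (finSuccEquiv R γ).apply_symm_apply g]
  rw [coeff_coeff_finSuccEquiv, Finsupp.cons_tail]

end Shear

lemma coeff_zero_finSuccEquiv_shear {K : Type} [Field K] {γ n : ℕ} (P : MvPolynomial (Fin (γ + 1)) K)
    (hP : P.IsHomogeneous n) (c : Fin γ → K) :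
    constantCoeff (PowerSeries.coeff n (finSuccEquiv K γ (shear c P))) =
      MvPolynomial.eval (Fin.cons 1 c) P := by
  let v : Fin (γ + 1) → K := Fin.cons 1 c
  let Λ : MvPolynomial (Fin (γ + 1)) K →+* PowerSeries K :=
    (PowerSeries.map constantCoeff).comp (((finSuccEquiv K γ).toAlgHom.toRingHom.comp (shear c)).comp
      MvPolynomial.coeToMvPowerSeries.ringHom)
  have h1 : Λ = MvPolynomial.eval₂Hom PowerSeries.C (fun i => PowerSeries.C (v i) * PowerSeries.X) := by
    apply MvPolynomial.ringHom_ext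
    · intro r
      simp [Λ, finSuccEquiv_C]
    · intro t
      refine Fin.cases ?_ (fun j => ?_) t
      · simp [Λ, finSuccEquiv_X_zero, v]
      · simp [Λ, finSuccEquiv_X_zero, finSuccEquiv_X_succ, finSuccEquiv_C, v]
  have h2 : Λ P = PowerSeries.C (MvPolynomial.eval v P) * PowerSeries.X ^ n := by
    rw [h1, MvPolynomial.coe_eval₂Hom, MvPolynomial.eval₂_eq, MvPolynomial.eval_eq, map_sum,
      Finset.sum_mul]
    refine Finset.sum_congr rfl fun d hd => ?_
    have hdn : ∑ i ∈ d.support, d i = n := by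
      have := hP (MvPolynomial.mem_support_iff.1 hd)
      rw [← this, Finsupp.weight_apply, Finsupp.sum]
      simp
    simp_rw [mul_pow]
    rw [Finset.prod_mul_distrib, Finset.prod_pow_eq_pow_sum, hdn, map_mul, map_prod, mul_assoc]
    simp_rw [map_pow]
  have h3 := congrArg (PowerSeries.coeff n) h2
  rw [PowerSeries.coeff_C_mul_X_pow, if_pos rfl] at h3
  rw [← h3]
  rfl

end MvPowerSeries

lemma MvPolynomial.exists_eval_cons_ne_zero {k K : Type} [Field k] [Infinite k] [Field K]
    [Algebra k K] {γ n : ℕ} (P : MvPolynomial (Fin (γ + 1)) K) (hP : P.IsHomogeneous n)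
    (h0 : P ≠ 0) :
    ∃ c : Fin γ → k, MvPolynomial.eval (Fin.cons 1 fun i => algebraMap k K (c i)) P ≠ 0 := by
  by_contra! hcon
  have : P * X 0 = 0 := by
    apply funext_set (fun _ : Fin (γ + 1) => Set.range (algebraMap k K))
      (fun _ => Set.infinite_range_of_injective (algebraMap k K).injective)
    intro x hx
    have hx' : ∀ i, ∃ a, algebraMap k K a = x i := fun i => hx i (Set.mem_univ _)
    choose a ha using hx'
    rw [map_mul, eval_X, map_zero]
    by_cases hx0 : x 0 = 0
    · rw [hx0, mul_zero]
    · have h1 := hcon (fun i => a i.succ / a 0)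
      have h2 : x = fun i => x 0 * (Fin.cons 1 fun i => algebraMap k K (a i.succ / a 0) :
          Fin (γ + 1) → K) i := by
        ext i
        refine Fin.cases ?_ (fun j => ?_) i
        · simp
        · simp only [Fin.cons_succ, map_div₀, ha]
          field_simp
      have h3 : eval x P = x 0 ^ n * eval (Fin.cons 1 fun i => algebraMap k K (a i.succ / a 0)) P := by
        conv_lhs => rw [h2]
        rw [eval_eq, eval_eq, Finset.mul_sum]
        refine Finset.sum_congr rfl fun d hd => ?_
        have hdn : ∑ i ∈ d.support, d i = n := by
          have := hP (mem_support_iff.1 hd)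
          rw [← this, Finsupp.weight_apply, Finsupp.sum]
          simp
        simp_rw [mul_pow]
        rw [Finset.prod_mul_distrib, Finset.prod_pow_eq_pow_sum, hdn]
        ring
      rw [h3, h1, mul_zero, zero_mul]
  rcases mul_eq_zero.1 this with h | h
  · exact h0 h
  · exact X_ne_zero _ h

/-- A generic linear change of variables makes a power series regular in the first variable. -/
lemma MvPowerSeries.exists_shear_regular {k K : Type} [Field k] [Infinite k] [Field K]
    [Algebra k K] {γ : ℕ} {δ : MvPowerSeries (Fin (γ + 1)) K} (hδ : δ ≠ 0) :
    ∃ (n : ℕ) (c : Fin γ → k),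
      (∀ i < n, PowerSeries.coeff i (finSuccEquiv K γ (shear (fun i => algebraMap k K (c i)) δ)) ∈
        (orderFiltration (Fin γ) K).F 1) ∧
      PowerSeries.coeff n (finSuccEquiv K γ (shear (fun i => algebraMap k K (c i)) δ)) ∉
        (orderFiltration (Fin γ) K).F 1 := by
  classical
  have hex : ∃ n, δ ∉ (orderFiltration (Fin (γ + 1)) K).F (n + 1) := by
    by_contra! h
    apply hδ
    apply (orderFiltration (Fin (γ + 1)) K).sep
    intro n
    exact (orderFiltration (Fin (γ + 1)) K).succ_le n (h n)
  let n := Nat.find hex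
  have hn : δ ∉ (orderFiltration (Fin (γ + 1)) K).F (n + 1) := Nat.find_spec hex
  have hn' : δ ∈ (orderFiltration (Fin (γ + 1)) K).F n := by
    rcases Nat.eq_zero_or_pos n with h | h
    · rw [h]; exact CompleteFiltration.mem_zero _ _
    · obtain ⟨m, hm⟩ := Nat.exists_eq_succ_of_ne_zero h.ne'
      have := Nat.find_min hex (m := m) (by change m < n; omega)
      rw [not_not] at this
      rwa [hm]
  let P : MvPolynomial (Fin (γ + 1)) K := MvPowerSeries.truncTotal (n + 1) δ
  have hPδ := sub_truncTotal_mem (n + 1) δ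
  have hP : P.IsHomogeneous n := by
    intro e he
    have h1 : e.degree < n + 1 := by
      by_contra h
      exact he (MvPowerSeries.coeff_truncTotal_eq_zero _ (not_lt.1 h))
    have h2 : ¬ e.degree < n := by
      intro h
      apply he
      rw [MvPowerSeries.coeff_truncTotal _ h1]
      exact hn' e h
    have h3 : Finsupp.weight 1 e = e.degree := by
      rw [Finsupp.weight_apply, Finsupp.degree_apply, Finsupp.sum]
      simp
    omega
  have hP0 : P ≠ 0 := by
    intro h
    apply hn
    have := hPδ
    change δ - (P : MvPowerSeries _ _) ∈ _ at this
    rwa [h, MvPolynomial.coe_zero, sub_zero] at this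
  obtain ⟨c, hc⟩ := MvPolynomial.exists_eval_cons_ne_zero (k := k) P hP hP0
  refine ⟨n, c, ?_, ?_⟩
  · intro i hi
    have := finSuccEquiv_mem.2 (shear_mem (fun i => algebraMap k K (c i)) hn')
    exact (orderFiltration (Fin γ) K).anti (by omega) (this i)
  · intro h
    apply hc
    rw [← coeff_zero_finSuccEquiv_shear P hP, ← mem_orderFiltration_one]
    have h1 := finSuccEquiv_mem.2 (shear_mem (fun i => algebraMap k K (c i)) hPδ) n
    rw [Nat.add_sub_cancel_left, map_sub, map_sub, map_sub] at h1
    have := Ideal.sub_mem _ h h1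
    rwa [sub_sub_cancel] at this

namespace PolyPower

lemma approx_zero (k K : Type) [Field k] [Field K] [Algebra k K] : Approx k K 0 := by
  classical
  intro α β υ _ _ _ φ hφ _ κ
  have hF : ∀ f ∈ (orderFiltration (Fin 0) K).F 1, f = 0 := by
    intro f hf
    ext e
    rw [Subsingleton.elim e 0]
    exact hf 0 (by simp)
  let S : Subalgebra k K := Algebra.adjoin k
    (Set.range fun a : α => MvPowerSeries.constantCoeff (φ (mv k υ (Sum.inl a))))
  refine ⟨S, ?_, φ, fun _ => rfl, ?_, fun a => by rw [sub_self]; exact Ideal.zero_mem _,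
    fun _ h => h⟩
  · exact Subalgebra.fg_def.2 ⟨_, Set.finite_range _, rfl⟩
  · intro a e
    have h1 : φ a - φ (MvPowerSeries.C (MvPowerSeries.constantCoeff a)) = 0 := by
      rw [← map_sub]
      apply hF
      refine ringHom_mem_filtration (orderFiltration (Fin 0) K) φ.toRingHom hφ ?_
      rw [mem_orderFiltration_one]
      simp
    rw [sub_eq_zero.1 h1, Subsingleton.elim e 0]
    induction (MvPowerSeries.constantCoeff a : MvPolynomial α k) using
      MvPolynomial.induction_on with
    | C r =>
      have : φ (MvPowerSeries.C (MvPolynomial.C r)) = algebraMap k _ r := by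
        rw [← φ.commutes r, MvPowerSeries.algebraMap_apply, MvPolynomial.algebraMap_eq]
      rw [this, MvPowerSeries.algebraMap_apply]
      simp
    | add p q hp hq =>
      rw [map_add, map_add, map_add]
      exact S.add_mem hp hq
    | mul_X p i hp =>
      rw [map_mul, map_mul]
      rw [MvPowerSeries.coeff_zero_eq_constantCoeff_apply] at hp ⊢
      rw [map_mul]
      exact S.mul_mem hp (Algebra.subset_adjoin ⟨i, rfl⟩)

lemma approx_succ {k K : Type} [Field k] [Infinite k] [Field K] [Algebra k K] [CharZero K] {γ : ℕ}
    (hA : Approx k K γ) : Approx k K (γ + 1) := by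
  intro α β υ _ _ _ φ hφ hυ κ
  have : IsDomain (MvPowerSeries (Fin (γ + 1)) K) := NoZeroDivisors.to_isDomain _
  obtain ⟨ι, _, _, ⟨s⟩⟩ := exists_selection φ
  obtain ⟨n, c, hlow, hn⟩ := MvPowerSeries.exists_shear_regular (k := k) s.δ_ne
  set cK : Fin γ → K := fun i => algebraMap k K (c i) with hcK
  have hc2 : -cK + cK = 0 := neg_add_cancel _
  have hneg : -cK = fun i => algebraMap k K (-c i) := by ext i; simp [hcK]
  let Φ : MvPowerSeries (Fin (γ + 1)) K →ₐ[k] PowerSeries (MvPowerSeries (Fin γ) K) :=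
    { (MvPowerSeries.finSuccEquiv K γ).toAlgHom.toRingHom.comp (MvPowerSeries.shear cK) with
      commutes' := by
        intro r
        change MvPowerSeries.finSuccEquiv K γ (MvPowerSeries.shear cK _) = _
        rw [MvPowerSeries.algebraMap_apply, MvPowerSeries.shear_C, MvPowerSeries.finSuccEquiv_C,
          algebraMap_powerSeries, MvPowerSeries.algebraMap_apply] }
  let Θ : PowerSeries (MvPowerSeries (Fin γ) K) →ₐ[k] MvPowerSeries (Fin (γ + 1)) K :=
    { (MvPowerSeries.shear (-cK)).comp (MvPowerSeries.finSuccEquiv K γ).symm.toAlgHom.toRingHom with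
      commutes' := by
        intro r
        change MvPowerSeries.shear (-cK) ((MvPowerSeries.finSuccEquiv K γ).symm _) = _
        have : algebraMap k (PowerSeries (MvPowerSeries (Fin γ) K)) r =
          MvPowerSeries.finSuccEquiv K γ (MvPowerSeries.C (algebraMap k K r)) := by
          rw [MvPowerSeries.finSuccEquiv_C, algebraMap_powerSeries, MvPowerSeries.algebraMap_apply]
        rw [this, AlgEquiv.symm_apply_apply, MvPowerSeries.shear_C,
          MvPowerSeries.algebraMap_apply] }
  have hΦ : ∀ g, Φ g = MvPowerSeries.finSuccEquiv K γ (MvPowerSeries.shear cK g) := fun _ => rfl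
  have hΘ : ∀ g, Θ g = MvPowerSeries.shear (-cK) ((MvPowerSeries.finSuccEquiv K γ).symm g) :=
    fun _ => rfl
  have hΘΦ : ∀ g, Θ (Φ g) = g := by
    intro g
    rw [hΘ, hΦ, AlgEquiv.symm_apply_apply, MvPowerSeries.shear_comp hc2]
  have hΦF : ∀ {m g}, g ∈ (orderFiltration (Fin (γ + 1)) K).F m →
      Φ g ∈ (orderFiltration (Fin γ) K).powerSeries.F m := fun h =>
    MvPowerSeries.finSuccEquiv_mem.2 (MvPowerSeries.shear_mem cK h)
  have hΘF : ∀ {m g}, g ∈ (orderFiltration (Fin γ) K).powerSeries.F m →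
      Θ g ∈ (orderFiltration (Fin (γ + 1)) K).F m := by
    intro m g h
    refine MvPowerSeries.shear_mem _ (MvPowerSeries.finSuccEquiv_mem.1 ?_)
    exact ((MvPowerSeries.finSuccEquiv K γ).apply_symm_apply g).symm ▸ h
  have hκ' : 1 ≤ max κ 1 := le_max_right _ _
  obtain ⟨S, hS, ψ, hψS, hψw, hψκ, hψ⟩ := hA.step (Φ.comp φ) (fun t => hΦF (hφ t))
    (by
      intro u
      obtain ⟨m, hm⟩ := hυ u
      refine ⟨MvPowerSeries.finSuccEquiv k γ (MvPowerSeries.shear c m), ?_, ?_⟩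
      · have hm1 : m ∈ (orderFiltration (Fin (γ + 1)) k).F 1 := by
          intro e he
          have := hφ (Sum.inr u) e he
          change MvPowerSeries.coeff e (φ (pv k α β u)) = 0 at this
          rw [hm, MvPowerSeries.coeff_map] at this
          exact (map_eq_zero _).1 this
        exact MvPowerSeries.finSuccEquiv_mem.2 (MvPowerSeries.shear_mem c hm1) 0
      · rw [AlgHom.comp_apply, hm, hΦ, ← MvPowerSeries.map_shear, MvPowerSeries.finSuccEquiv_map])
    (s.map Φ.toRingHom (Function.LeftInverse.injective hΘΦ) (Φ.comp φ) fun _ => rfl) n hlow hn hκ'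
  refine ⟨S, hS, Θ.comp ψ, ?_, ?_, ?_, ?_⟩
  · intro u
    rw [AlgHom.comp_apply, hψw, AlgHom.comp_apply, hΘΦ]
  · intro a
    rw [AlgHom.comp_apply, hΘ, hneg]
    apply MvPowerSeries.coeff_shear_mem
    intro e
    rw [MvPowerSeries.coeff_eq_coeff_coeff]
    exact hψS _ _ _
  · intro a
    have h1 := (orderFiltration (Fin γ) K).powerSeries.anti (le_max_left κ 1) (hψκ a)
    have h2 := hΘF h1
    rwa [map_sub, AlgHom.comp_apply Φ, hΘΦ] at h2
  · intro a ha
    rw [AlgHom.comp_apply, hψ, map_zero]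
    rw [AlgHom.comp_apply, ha, map_zero]

theorem approx (k K : Type) [Field k] [Infinite k] [Field K] [Algebra k K] [CharZero K] (γ : ℕ) :
    Approx k K γ := by
  induction γ with
  | zero => exact approx_zero k K
  | succ γ ih => exact approx_succ ih

end PolyPower

/-! ### Ultrapower of the reals -/

/-- The ultrapower of the real field. -/
def UltraReal : Type := Filter.Germ (Filter.hyperfilter ℕ : Filter ℕ) ℝ

namespace UltraReal

instance : Field UltraReal :=
  inferInstanceAs (Field (Filter.Germ (Filter.hyperfilter ℕ : Filter ℕ) ℝ))

instance : CharZero UltraReal :=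
  inferInstanceAs (CharZero (Filter.Germ (Filter.hyperfilter ℕ : Filter ℕ) ℝ))

/-- The class of a sequence. -/
def ofSeqHom : (ℕ → ℝ) →+* UltraReal :=
  Filter.Germ.coeRingHom (Filter.hyperfilter ℕ : Filter ℕ)

instance : Algebra ℝ UltraReal := (ofSeqHom.comp (algebraMap ℝ (ℕ → ℝ))).toAlgebra

/-- The class of a sequence, as an algebra homomorphism. -/
def ofSeq : (ℕ → ℝ) →ₐ[ℝ] UltraReal := { ofSeqHom with commutes' := fun _ => rfl }

lemma ofSeq_surjective : Function.Surjective ofSeq := fun x =>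
  Quotient.inductionOn' x fun s => ⟨s, rfl⟩

lemma ofSeq_eq {s t : ℕ → ℝ} :
    ofSeq s = ofSeq t ↔ ∀ᶠ n in (Filter.hyperfilter ℕ : Filter ℕ), s n = t n :=
  Filter.Germ.coe_eq

/-- A finitely generated algebra of hyperreals admits approximate real points. -/
lemma exists_specialization {S : Subalgebra ℝ UltraReal} (hS : S.FG) :
    ∃ ρ : ℕ → (S →ₐ[ℝ] ℝ), ∀ (t : ℕ → ℝ) (ht : ofSeq t ∈ S),
      ∀ᶠ n in (Filter.hyperfilter ℕ : Filter ℕ), ρ n ⟨ofSeq t, ht⟩ = t n := by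
  obtain ⟨m, f, hf⟩ := Algebra.FiniteType.iff_quotient_mvPolynomial''.1
    ((Subalgebra.fg_iff_finiteType S).1 hS)
  choose ζ hζ using fun i => ofSeq_surjective (f (MvPolynomial.X i) : UltraReal)
  have hfe : ∀ p, (f p : UltraReal) = ofSeq (MvPolynomial.aeval ζ p) := by
    intro p
    have : S.val.comp f = ofSeq.comp (MvPolynomial.aeval ζ) := by
      ext i
      simp [hζ]
    exact AlgHom.congr_fun this p
  have hev : ∀ n (p : MvPolynomial (Fin m) ℝ), MvPolynomial.aeval ζ p n = MvPolynomial.aeval (fun i => ζ i n) p := by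
    intro n p
    have : (Pi.evalAlgHom ℝ (fun _ : ℕ => ℝ) n).comp (MvPolynomial.aeval ζ) =
        MvPolynomial.aeval (fun i => ζ i n) := by
      ext i
      simp
    exact AlgHom.congr_fun this p
  obtain ⟨G, hG⟩ := (isNoetherianRing_iff_ideal_fg _).1
    (inferInstance : IsNoetherianRing (MvPolynomial (Fin m) ℝ)) (RingHom.ker f.toRingHom)
  have h1 : ∀ᶠ n in (Filter.hyperfilter ℕ : Filter ℕ), ∀ p ∈ G,
      MvPolynomial.aeval ζ p n = (0 : ℕ → ℝ) n := by
    rw [Filter.eventually_all_finset]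
    intro p hp
    rw [← ofSeq_eq, ← hfe, map_zero]
    have : p ∈ RingHom.ker f.toRingHom := hG ▸ Ideal.subset_span hp
    exact congrArg Subtype.val this
  have h2 : ∀ᶠ n in (Filter.hyperfilter ℕ : Filter ℕ), ∃ ρ : S →ₐ[ℝ] ℝ,
      ∀ p, ρ (f p) = MvPolynomial.aeval ζ p n := by
    filter_upwards [h1] with n hn
    refine ⟨AlgHom.liftOfSurjective f hf (MvPolynomial.aeval fun i => ζ i n) ?_, ?_⟩
    · rw [← hG, Ideal.span_le]
      intro p hp
      change MvPolynomial.aeval (fun i => ζ i n) p = 0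
      rw [← hev, hn p hp]
      rfl
    · intro p
      rw [AlgHom.liftOfSurjective_apply, hev]
  obtain ⟨ρ, hρ⟩ := h2.choice
  refine ⟨ρ, fun t ht => ?_⟩
  obtain ⟨p, hp⟩ := hf ⟨ofSeq t, ht⟩
  have h3 : ofSeq (MvPolynomial.aeval ζ p) = ofSeq t := by rw [← hfe, hp]
  filter_upwards [hρ, ofSeq_eq.1 h3] with n hn hn'
  rw [← hp, hn, hn']

end UltraReal

/-! ### Growth of polynomials near the origin -/

lemma Polynomial.coeff_eq_zero_of_bound (η : ℕ) : ∀ (P : Polynomial ℝ) (C ε : ℝ), 0 < ε →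
    (∀ t, 0 < t → t < ε → |P.eval t| ≤ C * t ^ η) → ∀ i < η, P.coeff i = 0 := by
  induction η with
  | zero => intro P C ε _ _ i hi; omega
  | succ η ih =>
    intro P C ε hε h
    have h0 : P.coeff 0 = 0 := by
      have h1 : Filter.Tendsto (fun t => |P.eval t|) (nhdsWithin 0 (Set.Ioi 0))
          (nhds |P.eval 0|) :=
        (P.continuous.abs.tendsto 0).mono_left nhdsWithin_le_nhds
      have h2 : Filter.Tendsto (fun t : ℝ => C * t ^ (η + 1)) (nhdsWithin 0 (Set.Ioi 0))
          (nhds (C * 0 ^ (η + 1))) :=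
        (Continuous.tendsto (by fun_prop) 0).mono_left nhdsWithin_le_nhds
      have h3 := le_of_tendsto_of_tendsto h1 h2 (by
        filter_upwards [Ioo_mem_nhdsGT hε] with t ht
        exact h t ht.1 ht.2)
      rw [zero_pow (by omega), mul_zero] at h3
      rw [Polynomial.coeff_zero_eq_eval_zero]
      exact abs_nonpos_iff.1 h3
    have hP := P.divX_mul_X_add
    rw [h0, map_zero, add_zero] at hP
    intro i hi
    rcases i with _ | i
    · exact h0
    · rw [← hP, Polynomial.coeff_mul_X]
      refine ih P.divX C ε hε ?_ i (by omega)
      intro t ht htε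
      have h1 := h t ht htε
      rw [← hP, Polynomial.eval_mul, Polynomial.eval_X, abs_mul, abs_of_pos ht, pow_succ,
        ← mul_assoc] at h1
      exact le_of_mul_le_mul_right h1 ht

lemma MvPolynomial.bound_iff {g : ℕ} (η : ℕ) (Q : MvPolynomial (Fin g) ℝ) :
    (∃ C ε : ℝ, 0 < ε ∧ ∀ u : Fin g → ℝ, ‖u‖ < ε → |eval u Q| ≤ C * ‖u‖ ^ η) ↔
      (Q : MvPowerSeries (Fin g) ℝ) ∈ (orderFiltration (Fin g) ℝ).F η := by
  classical
  constructor
  · rintro ⟨C, ε, hε, h⟩ e he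
    rw [coeff_coe]
    have h0 : homogeneousComponent e.degree Q = 0 := by
      apply MvPolynomial.funext
      intro u
      let P : Polynomial ℝ := aeval (fun j => Polynomial.C (u j) * Polynomial.X) Q
      have hev : ∀ t, P.eval t = eval (t • u) Q := by
        intro t
        change ((Polynomial.evalRingHom t).comp
          (aeval fun j => Polynomial.C (u j) * Polynomial.X).toRingHom) Q = _
        congr 1
        ext j
        · simp
        · simp only [RingHom.coe_comp, Function.comp_apply, AlgHom.toRingHom_eq_coe,
            RingHom.coe_coe, aeval_X, Polynomial.coe_evalRingHom, Polynomial.eval_mul,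
            Polynomial.eval_C, Polynomial.eval_X, eval_X, Pi.smul_apply, smul_eq_mul]
          exact mul_comm _ _
      have hco : P.coeff e.degree = eval u (homogeneousComponent e.degree Q) := by
        rw [homogeneousComponent_apply, map_sum, Finset.sum_filter]
        simp only [P]
        rw [aeval_def, eval₂_eq, Polynomial.finsetSum_coeff]
        refine Finset.sum_congr rfl fun d _ => ?_
        simp_rw [mul_pow]
        rw [Finset.prod_mul_distrib, Finset.prod_pow_eq_pow_sum]
        have : ∏ i ∈ d.support, Polynomial.C (u i) ^ d i =
            Polynomial.C (∏ i ∈ d.support, u i ^ d i) := by simp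
        rw [this, ← mul_assoc, Polynomial.algebraMap_eq, ← Polynomial.C_mul,
          Polynomial.coeff_C_mul_X_pow, eval_monomial, Finsupp.degree_apply]
        simp only [Finsupp.prod, eq_comm]
        rfl
      rw [map_zero, ← hco]
      refine Polynomial.coeff_eq_zero_of_bound η P (C * ‖u‖ ^ η) (ε / (‖u‖ + 1))
        (by positivity) ?_ _ he
      intro t ht htε
      rw [hev]
      have h1 : ‖t • u‖ = t * ‖u‖ := by rw [norm_smul, Real.norm_of_nonneg ht.le]
      have h2 := h (t • u) (by
        rw [h1]
        rw [lt_div_iff₀ (by positivity)] at htε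
        nlinarith)
      rw [h1, mul_pow] at h2
      linarith
    have := congrArg (coeff e) h0
    rwa [coeff_homogeneousComponent, if_pos rfl] at this
  · intro h
    refine ⟨∑ d ∈ Q.support, |coeff d Q|, 1, one_pos, ?_⟩
    intro u hu
    rw [eval_eq', Finset.sum_mul]
    refine (Finset.abs_sum_le_sum_abs _ _).trans (Finset.sum_le_sum fun d hd => ?_)
    rw [abs_mul, Finset.abs_prod]
    refine mul_le_mul_of_nonneg_left ?_ (abs_nonneg _)
    have hd' : η ≤ ∑ i, d i := by
      by_contra hlt
      apply mem_support_iff.1 hd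
      rw [← coeff_coe]
      apply h
      rw [Finsupp.degree_eq_sum]
      omega
    calc ∏ i, |u i ^ d i| ≤ ∏ i, ‖u‖ ^ d i := by
          refine Finset.prod_le_prod (fun _ _ => abs_nonneg _) fun i _ => ?_
          rw [abs_pow]
          exact pow_le_pow_left₀ (abs_nonneg _) (norm_le_pi_norm u i) _
      _ = ‖u‖ ^ ∑ i, d i := Finset.prod_pow_eq_pow_sum _ _ _
      _ ≤ ‖u‖ ^ η := pow_le_pow_of_le_one (norm_nonneg _) hu.le hd'

/-! ### Coefficient families and power series -/

section Families

variable {a b g : ℕ}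

/-- The power series with a given coefficient family. -/
def familySeries {δ : ℕ} (c : (Fin g → ℕ) → (Fin δ → ℝ)) (i : Fin δ) : MvPowerSeries (Fin g) ℝ :=
  fun e => c e i

lemma coeff_familySeries {δ : ℕ} (c : (Fin g → ℕ) → (Fin δ → ℝ)) (i : Fin δ) (e : Fin g →₀ ℕ) :
    MvPowerSeries.coeff e (familySeries c i) = c e i := rfl

/-- The truncation of a power series as a polynomial. -/
def familyTrunc {δ : ℕ} (c : (Fin g → ℕ) → (Fin δ → ℝ)) (k : ℕ) (i : Fin δ) :
    MvPolynomial (Fin g) ℝ :=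
  ∑ dd ∈ (Fintype.piFinset fun _ : Fin g => Finset.range k).filter (fun dd => (∑ j, dd j) < k),
    MvPolynomial.C (c dd i) * ∏ j, MvPolynomial.X j ^ dd j

lemma eval_familyTrunc {δ : ℕ} (c : (Fin g → ℕ) → (Fin δ → ℝ)) (k : ℕ) (i : Fin δ)
    (u : Fin g → ℝ) : MvPolynomial.eval u (familyTrunc c k i) = truncPoly g δ c k u i := by
  simp [familyTrunc, truncPoly]

lemma mem_truncIndex {γ k : ℕ} (e : Fin γ → ℕ) (he : ∑ j, e j < k) :
    e ∈ Fintype.piFinset fun _ : Fin γ => Finset.range k := by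
  rw [Fintype.mem_piFinset]
  intro i
  rw [Finset.mem_range]
  exact (Finset.single_le_sum (fun _ _ => Nat.zero_le _) (Finset.mem_univ i)).trans_lt he

lemma familyTrunc_sub_mem {δ : ℕ} (c : (Fin g → ℕ) → (Fin δ → ℝ)) (k : ℕ) (i : Fin δ) :
    (familyTrunc c k i : MvPowerSeries (Fin g) ℝ) - familySeries c i ∈
      (orderFiltration (Fin g) ℝ).F k := by
  classical
  intro e he
  rw [Finsupp.degree_eq_sum] at he
  have hmon : ∀ dd : Fin g → ℕ, MvPolynomial.C (c dd i) * ∏ j, MvPolynomial.X j ^ dd j =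
      MvPolynomial.monomial (Finsupp.equivFunOnFinite.symm dd) (c dd i) := by
    intro dd
    rw [MvPolynomial.monomial_eq, Finsupp.prod_fintype _ _ (by simp)]
    rfl
  rw [map_sub, MvPolynomial.coeff_coe, coeff_familySeries, familyTrunc, MvPolynomial.coeff_sum]
  simp_rw [hmon, MvPolynomial.coeff_monomial]
  rw [Finset.sum_eq_single (e : Fin g → ℕ)]
  · simp
  · intro dd _ hdd
    rw [if_neg]
    rintro rfl
    exact hdd rfl
  · intro h
    exact absurd (Finset.mem_filter.2 ⟨mem_truncIndex e he, he⟩) h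

/-- The element of `ℝ[x][[y,u]]` with a given coefficient family. -/
def familyPolyPower (h : ((Fin b → ℕ) × (Fin g → ℕ)) → MvPolynomial (Fin a) ℝ) :
    PolyPower ℝ (Fin a) (Fin b) (Fin g) :=
  fun e => h (fun i => e (Sum.inl i), fun j => e (Sum.inr j))

/-- The index set of the truncated composite. -/
def truncIndex (b g η : ℕ) : Finset ((Fin b → ℕ) × (Fin g → ℕ)) :=
  ((Fintype.piFinset fun _ : Fin b => Finset.range η) ×ˢ
      (Fintype.piFinset fun _ : Fin g => Finset.range η)).filter
      (fun bc => (∑ i, bc.1 i) + (∑ j, bc.2 j) < η)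

/-- The truncation of an element of `ℝ[x][[y,u]]`. -/
def polyPowerTrunc (h : ((Fin b → ℕ) × (Fin g → ℕ)) → MvPolynomial (Fin a) ℝ) (η : ℕ) :
    PolyPower ℝ (Fin a) (Fin b) (Fin g) :=
  ∑ bc ∈ truncIndex b g η, MvPowerSeries.C (h bc) *
    (∏ i, MvPowerSeries.X (Sum.inl i) ^ bc.1 i) * ∏ j, MvPowerSeries.X (Sum.inr j) ^ bc.2 j

lemma familyPolyPower_sub_mem (h : ((Fin b → ℕ) × (Fin g → ℕ)) → MvPolynomial (Fin a) ℝ) (η : ℕ) :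
    familyPolyPower h - polyPowerTrunc h η ∈
      (orderFiltration (Fin b ⊕ Fin g) (MvPolynomial (Fin a) ℝ)).F η := by
  classical
  intro e he
  rw [Finsupp.degree_eq_sum, Fintype.sum_sum_type] at he
  have hmon : ∀ bc : (Fin b → ℕ) × (Fin g → ℕ), MvPowerSeries.C (h bc) *
      (∏ i, MvPowerSeries.X (Sum.inl i) ^ bc.1 i) * ∏ j, MvPowerSeries.X (Sum.inr j) ^ bc.2 j =
      ((MvPolynomial.monomial (Finsupp.equivFunOnFinite.symm (Sum.elim bc.1 bc.2)) (h bc) :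
        MvPolynomial (Fin b ⊕ Fin g) (MvPolynomial (Fin a) ℝ)) :
          PolyPower ℝ (Fin a) (Fin b) (Fin g)) := by
    intro bc
    rw [MvPolynomial.monomial_eq, Finsupp.prod_fintype _ _ (by simp), Fintype.prod_sum_type]
    change _ = MvPolynomial.coeToMvPowerSeries.ringHom _
    simp only [map_mul, map_prod, map_pow, MvPolynomial.coeToMvPowerSeries.ringHom_apply,
      MvPolynomial.coe_C, MvPolynomial.coe_X, mul_assoc]
    rfl
  rw [map_sub, polyPowerTrunc, map_sum]
  simp_rw [hmon, MvPolynomial.coeff_coe, MvPolynomial.coeff_monomial]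
  rw [Finset.sum_eq_single (fun i => e (Sum.inl i), fun j => e (Sum.inr j)), if_pos, sub_eq_zero]
  · rfl
  · ext t
    rcases t with i | j <;> rfl
  · intro bc _ hbc
    rw [if_neg]
    rintro rfl
    exact hbc rfl
  · intro hn
    refine absurd (Finset.mem_filter.2 ⟨Finset.mem_product.2 ⟨?_, ?_⟩, he⟩) hn
    · exact mem_truncIndex _ (by dsimp only; omega)
    · exact mem_truncIndex _ (by dsimp only; omega)

/-- The truncated composite as a polynomial. -/
def compPoly (h : ((Fin b → ℕ) × (Fin g → ℕ)) → MvPolynomial (Fin a) ℝ)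
    (x : (Fin g → ℕ) → (Fin a → ℝ)) (y : (Fin g → ℕ) → (Fin b → ℝ)) (η : ℕ) :
    MvPolynomial (Fin g) ℝ :=
  ∑ bc ∈ truncIndex b g η, MvPolynomial.aeval (familyTrunc x η) (h bc) *
    (∏ i, familyTrunc y η i ^ bc.1 i) * ∏ j, MvPolynomial.X j ^ bc.2 j

lemma eval_compPoly (h : ((Fin b → ℕ) × (Fin g → ℕ)) → MvPolynomial (Fin a) ℝ)
    (x : (Fin g → ℕ) → (Fin a → ℝ)) (y : (Fin g → ℕ) → (Fin b → ℝ)) (η : ℕ) (u : Fin g → ℝ) :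
    MvPolynomial.eval u (compPoly h x y η) = compTrunc a b g h x y η u := by
  have hev : ∀ p : MvPolynomial (Fin a) ℝ,
      MvPolynomial.eval u (MvPolynomial.aeval (familyTrunc x η) p) =
        MvPolynomial.eval (truncPoly g a x η u) p := by
    intro p
    have : (MvPolynomial.eval u).comp (MvPolynomial.aeval (familyTrunc x η)).toRingHom =
        MvPolynomial.eval (truncPoly g a x η u) := by
      ext i
      · simp
      · simp [eval_familyTrunc]
    exact RingHom.congr_fun this p
  rw [compPoly, compTrunc, map_sum]
  refine Finset.sum_congr rfl fun bc _ => ?_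
  simp only [map_mul, map_prod, map_pow, hev, eval_familyTrunc, MvPolynomial.eval_X]

/-- The homomorphism `θ` substitutes the power series with coefficient families `x` and `y`. -/
structure IsSubstitution (x : (Fin g → ℕ) → (Fin a → ℝ)) (y : (Fin g → ℕ) → (Fin b → ℝ))
    (θ : PolyPower ℝ (Fin a) (Fin b) (Fin g) →ₐ[ℝ] MvPowerSeries (Fin g) ℝ) : Prop where
  inl : ∀ i, θ (PolyPower.mv ℝ (Fin g) (Sum.inl i)) = familySeries x i
  inr : ∀ i, θ (PolyPower.mv ℝ (Fin g) (Sum.inr i)) = familySeries y i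
  pv : ∀ j, θ (PolyPower.pv ℝ (Fin a) (Fin b) j) = MvPowerSeries.X j

variable {x : (Fin g → ℕ) → (Fin a → ℝ)} {y : (Fin g → ℕ) → (Fin b → ℝ)}
    {θ : PolyPower ℝ (Fin a) (Fin b) (Fin g) →ₐ[ℝ] MvPowerSeries (Fin g) ℝ}

lemma IsSubstitution.compPoly_sub_mem (hθ : IsSubstitution x y θ) (hy : y (fun _ => 0) = 0)
    (h : ((Fin b → ℕ) × (Fin g → ℕ)) → MvPolynomial (Fin a) ℝ) (η : ℕ) :
    (compPoly h x y η : MvPowerSeries (Fin g) ℝ) - θ (familyPolyPower h) ∈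
      (orderFiltration (Fin g) ℝ).F η := by
  have hX : ∀ t, θ (MvPowerSeries.X t) ∈ (orderFiltration (Fin g) ℝ).F 1 := by
    apply PolyPower.forall_X_mem
    · intro i
      rw [hθ.inr, mem_orderFiltration_one]
      exact congrFun hy i
    · intro j
      rw [hθ.pv]
      exact X_mem_orderFiltration _
  have h1 := ringHom_mem_filtration _ θ.toRingHom hX (familyPolyPower_sub_mem h η)
  change θ _ ∈ _ at h1
  rw [map_sub] at h1
  let π := Ideal.Quotient.mk ((orderFiltration (Fin g) ℝ).F η)
  rw [← Ideal.Quotient.eq_zero_iff_mem, map_sub, sub_eq_zero] at h1 ⊢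
  rw [h1]
  change π _ = π _
  have hx : ∀ i, π (familyTrunc x η i) = π (familySeries x i) := fun i =>
    Ideal.Quotient.eq.2 (familyTrunc_sub_mem x η i)
  have hy : ∀ i, π (familyTrunc y η i) = π (familySeries y i) := fun i =>
    Ideal.Quotient.eq.2 (familyTrunc_sub_mem y η i)
  have hp : ∀ p : MvPolynomial (Fin a) ℝ,
      π ((MvPolynomial.aeval (familyTrunc x η) p : MvPolynomial (Fin g) ℝ)) =
        π (θ (MvPowerSeries.C p)) := by
    intro p
    have : (π.comp MvPolynomial.coeToMvPowerSeries.ringHom).comp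
        (MvPolynomial.aeval (familyTrunc x η)).toRingHom =
        (π.comp θ.toRingHom).comp MvPowerSeries.C := by
      apply MvPolynomial.ringHom_ext
      · intro r
        have : θ (MvPowerSeries.C (MvPolynomial.C r)) = MvPowerSeries.C r := by
          have := θ.commutes r
          rwa [MvPowerSeries.algebraMap_apply, MvPolynomial.algebraMap_eq,
            MvPowerSeries.algebraMap_apply] at this
        simp [this]
      · intro i
        have := hθ.inl i
        rw [PolyPower.mv] at this
        simp [this, hx]
    exact RingHom.congr_fun this p
  have hinl : ∀ i, θ (MvPowerSeries.X (Sum.inl i)) = familySeries y i := hθ.inr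
  have hinr : ∀ j, θ (MvPowerSeries.X (Sum.inr j)) = MvPowerSeries.X j := hθ.pv
  have hcoe : ∀ p : MvPolynomial (Fin g) ℝ,
      (p : MvPowerSeries (Fin g) ℝ) = MvPolynomial.coeToMvPowerSeries.ringHom p := fun _ => rfl
  rw [compPoly, polyPowerTrunc, hcoe, map_sum, map_sum, map_sum, map_sum]
  refine Finset.sum_congr rfl fun bc _ => ?_
  simp only [map_mul, map_prod, map_pow, hinl, hinr, ← hy, ← hp]
  simp

lemma IsSubstitution.bound_iff (hθ : IsSubstitution x y θ) (hy : y (fun _ => 0) = 0)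
    (h : ((Fin b → ℕ) × (Fin g → ℕ)) → MvPolynomial (Fin a) ℝ) (η : ℕ) :
    (∃ C ε : ℝ, 0 < ε ∧ ∀ u : Fin g → ℝ, ‖u‖ < ε →
      |compTrunc a b g h x y η u| ≤ C * ‖u‖ ^ η) ↔
      θ (familyPolyPower h) ∈ (orderFiltration (Fin g) ℝ).F η := by
  simp_rw [← eval_compPoly]
  rw [MvPolynomial.bound_iff]
  have h1 := hθ.compPoly_sub_mem hy h η
  constructor
  · intro h2
    have := Ideal.sub_mem _ h2 h1
    rwa [sub_sub_cancel] at this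
  · intro h2
    have := Ideal.add_mem _ h1 h2
    rwa [sub_add_cancel] at this

end Families

lemma MvPowerSeries.exists_restrict {k A K : Type} [CommRing k] [CommRing A] [Algebra k A]
    [CommRing K] [Algebra k K] {τ : Type} (S : Subalgebra k K)
    (ψ : A →ₐ[k] MvPowerSeries τ K) (hψ : ∀ x e, coeff e (ψ x) ∈ S) :
    ∃ ψ' : A →ₐ[k] MvPowerSeries τ S, ∀ x e, ((coeff e (ψ' x) : S) : K) = coeff e (ψ x) := by
  let f : MvPowerSeries τ S →ₐ[k] MvPowerSeries τ K := mapAlgHom S.val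
  have hfc : ∀ x e, coeff e (f x) = ((coeff e x : S) : K) := fun x e => coeff_map _ _ _
  have hf : Function.Injective f := by
    intro x y hxy
    ext e
    rw [← hfc, ← hfc, hxy]
  have hr : ∀ x, ψ x ∈ f.range := by
    intro x
    refine ⟨fun e => ⟨coeff e (ψ x), hψ x e⟩, ?_⟩
    ext e
    exact hfc _ e
  refine ⟨(AlgEquiv.ofInjective f hf).symm.toAlgHom.comp (ψ.codRestrict f.range hr), ?_⟩
  intro x e
  rw [← hfc]
  have := (AlgEquiv.ofInjective f hf).apply_symm_apply (ψ.codRestrict f.range hr x)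
  exact congrArg (fun z : f.range => coeff e (z : MvPowerSeries τ K)) this

/-- Wavrik's approximation theorem. -/
theorem statement14 (a b g j₀ : ℕ)
    -- `h_j(x,y,u) ∈ ℝ[x][[y,u]]`, recorded by the coefficient families
    (h : Fin j₀ → ((Fin b → ℕ) × (Fin g → ℕ)) → MvPolynomial (Fin a) ℝ)
    (κ : ℕ) (hκ : 1 ≤ κ) :
    ∃ η : ℕ, 1 ≤ η ∧
      ∀ (xa : (Fin g → ℕ) → (Fin a → ℝ)) (ya : (Fin g → ℕ) → (Fin b → ℝ)),
        ya (fun _ => 0) = 0 →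
        -- `h_j(x^a(u), y^a(u), u) = O(|u|^η)`
        (∀ j : Fin j₀, ∃ C ε : ℝ, 0 < ε ∧ ∀ u : Fin g → ℝ, ‖u‖ < ε →
          |compTrunc a b g (h j) xa ya η u| ≤ C * ‖u‖ ^ η) →
        ∃ (xf : (Fin g → ℕ) → (Fin a → ℝ)) (yf : (Fin g → ℕ) → (Fin b → ℝ)),
          -- `x^f = x^a + O(|u|^κ)` and `y^f = y^a + O(|u|^κ)`
          (∀ dd : Fin g → ℕ, (∑ j, dd j) < κ → xf dd = xa dd) ∧
          (∀ dd : Fin g → ℕ, (∑ j, dd j) < κ → yf dd = ya dd) ∧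
          -- `h_j(x^f(u), y^f(u), u) ≡ 0`
          ∀ (j : Fin j₀) (K : ℕ), ∃ C ε : ℝ, 0 < ε ∧ ∀ u : Fin g → ℝ, ‖u‖ < ε →
            |compTrunc a b g (h j) xf yf K u| ≤ C * ‖u‖ ^ K := by  classical
  by_contra! hcon
  choose xs ys hys hbd hno using fun n : ℕ => hcon (n + 1) (by omega)
  obtain ⟨Θ, hΘv, hΘw, hΘX⟩ := PolyPower.exists_hom (k := ℝ) (υ := Fin g)
    (orderFiltration (Fin g) (ℕ → ℝ))
    (Sum.elim (fun (i : Fin a) (e : Fin g →₀ ℕ) (n : ℕ) => xs n e i)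
      (fun (i : Fin b) (e : Fin g →₀ ℕ) (n : ℕ) => ys n e i))
    (fun j : Fin g => MvPowerSeries.X j)
    (by
      intro i
      rw [mem_orderFiltration_one]
      funext n
      exact congrFun (hys n) i)
    (fun j => X_mem_orderFiltration j)
  let θ (n : ℕ) : PolyPower ℝ (Fin a) (Fin b) (Fin g) →ₐ[ℝ] MvPowerSeries (Fin g) ℝ :=
    (MvPowerSeries.mapAlgHom (Pi.evalAlgHom ℝ (fun _ : ℕ => ℝ) n)).comp Θ
  let φ : PolyPower ℝ (Fin a) (Fin b) (Fin g) →ₐ[ℝ] MvPowerSeries (Fin g) UltraReal :=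
    (MvPowerSeries.mapAlgHom UltraReal.ofSeq).comp Θ
  have hθc : ∀ n p e, MvPowerSeries.coeff e (θ n p) = MvPowerSeries.coeff e (Θ p) n :=
    fun n p e => MvPowerSeries.coeff_map
      (Pi.evalAlgHom ℝ (fun _ : ℕ => ℝ) n : (ℕ → ℝ) →+* ℝ) e (Θ p)
  have hφc : ∀ p e, MvPowerSeries.coeff e (φ p) = UltraReal.ofSeq (MvPowerSeries.coeff e (Θ p)) :=
    fun p e => MvPowerSeries.coeff_map (UltraReal.ofSeq : (ℕ → ℝ) →+* UltraReal) e (Θ p)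
  have hθ : ∀ n, IsSubstitution (xs n) (ys n) (θ n) := by
    intro n
    refine ⟨fun i => ?_, fun i => ?_, fun j => ?_⟩
    · ext e
      rw [hθc, hΘv]
      rfl
    · ext e
      rw [hθc, hΘv]
      rfl
    · ext e
      rw [hθc, hΘw, MvPowerSeries.coeff_X, MvPowerSeries.coeff_X]
      split_ifs <;> rfl
  have hφw : ∀ j, φ (PolyPower.pv ℝ (Fin a) (Fin b) j) = MvPowerSeries.X j := by
    intro j
    ext e
    rw [hφc, hΘw, MvPowerSeries.coeff_X, MvPowerSeries.coeff_X]
    split_ifs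
    · exact map_one _
    · exact map_zero _
  have hker : ∀ j, φ (familyPolyPower (h j)) = 0 := by
    intro j
    ext e
    rw [hφc, map_zero, ← map_zero UltraReal.ofSeq, UltraReal.ofSeq_eq]
    have h1 : ∀ᶠ n in (Filter.hyperfilter ℕ : Filter ℕ), e.degree < n + 1 := by
      apply Filter.hyperfilter_le_cofinite
      rw [Nat.cofinite_eq_atTop]
      filter_upwards [Filter.eventually_ge_atTop e.degree] with n hn
      omega
    filter_upwards [h1] with n hn
    rw [← hθc]
    exact ((hθ n).bound_iff (hys n) (h j) (n + 1)).1 (hbd n j) e hn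
  obtain ⟨S, hS, ψ, hψw, hψS, hψφ, hψ0⟩ := PolyPower.approx ℝ UltraReal g (Fin a) (Fin b) (Fin g)
    inferInstance inferInstance inferInstance φ
    (fun t => MvPowerSeries.map_mem_filtration (UltraReal.ofSeq : (ℕ → ℝ) →+* UltraReal) (hΘX t))
    (fun j => ⟨MvPowerSeries.X j, by rw [hφw, MvPowerSeries.map_X]⟩) κ
  obtain ⟨ψ', hψ'⟩ := MvPowerSeries.exists_restrict S ψ hψS
  obtain ⟨ρ, hρ⟩ := UltraReal.exists_specialization hS
  have hcoeff : ∀ p (e : Fin g →₀ ℕ), e.degree < κ →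
      ∀ᶠ n in (Filter.hyperfilter ℕ : Filter ℕ),
        ρ n (MvPowerSeries.coeff e (ψ' p)) = MvPowerSeries.coeff e (Θ p) n := by
    intro p e he
    have h1 : ((MvPowerSeries.coeff e (ψ' p) : S) : UltraReal) =
        UltraReal.ofSeq (MvPowerSeries.coeff e (Θ p)) := by
      rw [hψ', ← hφc, ← sub_eq_zero, ← map_sub]
      exact hψφ p e he
    have h2 : MvPowerSeries.coeff e (ψ' p) =
        ⟨UltraReal.ofSeq (MvPowerSeries.coeff e (Θ p)), h1 ▸ Subtype.property _⟩ :=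
      Subtype.ext h1
    rw [h2]
    exact hρ _ _
  have hall : ∀ᶠ n in (Filter.hyperfilter ℕ : Filter ℕ), ∀ v : Fin a ⊕ Fin b,
      ∀ dd ∈ Fintype.piFinset (fun _ : Fin g => Finset.range κ), (∑ j, dd j) < κ →
        ρ n (MvPowerSeries.coeff (Finsupp.equivFunOnFinite.symm dd)
          (ψ' (PolyPower.mv ℝ (Fin g) v))) =
          MvPowerSeries.coeff (Finsupp.equivFunOnFinite.symm dd)
            (Θ (PolyPower.mv ℝ (Fin g) v)) n := by
    rw [Filter.eventually_all]
    intro v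
    rw [Filter.eventually_all_finset]
    intro dd _
    by_cases hdd : ∑ j, dd j < κ
    · filter_upwards [hcoeff (PolyPower.mv ℝ (Fin g) v) (Finsupp.equivFunOnFinite.symm dd)
        (by rw [Finsupp.degree_eq_sum]; exact hdd)] with n hn _
      exact hn
    · exact Filter.Eventually.of_forall fun n hn => absurd hn hdd
  obtain ⟨n, hn⟩ := hall.exists
  let θ' : PolyPower ℝ (Fin a) (Fin b) (Fin g) →ₐ[ℝ] MvPowerSeries (Fin g) ℝ :=
    (MvPowerSeries.mapAlgHom (ρ n)).comp ψ'
  have hθ'c : ∀ p e, MvPowerSeries.coeff e (θ' p) = ρ n (MvPowerSeries.coeff e (ψ' p)) :=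
    fun p e => MvPowerSeries.coeff_map (ρ n : S →+* ℝ) e (ψ' p)
  let xf : (Fin g → ℕ) → (Fin a → ℝ) := fun dd i =>
    MvPowerSeries.coeff (Finsupp.equivFunOnFinite.symm dd)
      (θ' (PolyPower.mv ℝ (Fin g) (Sum.inl i)))
  let yf : (Fin g → ℕ) → (Fin b → ℝ) := fun dd i =>
    MvPowerSeries.coeff (Finsupp.equivFunOnFinite.symm dd)
      (θ' (PolyPower.mv ℝ (Fin g) (Sum.inr i)))
  have hxf : ∀ dd : Fin g → ℕ, (∑ j, dd j) < κ → xf dd = xs n dd := by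
    intro dd hdd
    funext i
    change MvPowerSeries.coeff _ (θ' _) = _
    rw [hθ'c, hn _ dd (mem_truncIndex dd hdd) hdd, hΘv]
    rfl
  have hyf : ∀ dd : Fin g → ℕ, (∑ j, dd j) < κ → yf dd = ys n dd := by
    intro dd hdd
    funext i
    change MvPowerSeries.coeff _ (θ' _) = _
    rw [hθ'c, hn _ dd (mem_truncIndex dd hdd) hdd, hΘv]
    rfl
  have hyf0 : yf (fun _ => 0) = 0 := by
    rw [hyf _ (by simp; omega), hys]
  have hθ' : IsSubstitution xf yf θ' := by
    refine ⟨fun i => ?_, fun i => ?_, fun j => ?_⟩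
    · ext e
      rw [coeff_familySeries]
      simp only [xf, Finsupp.equivFunOnFinite_symm_coe]
    · ext e
      rw [coeff_familySeries]
      simp only [yf, Finsupp.equivFunOnFinite_symm_coe]
    · have h1 : ψ' (PolyPower.pv ℝ (Fin a) (Fin b) j) = MvPowerSeries.X j := by
        ext e
        rw [hψ', hψw, hφw, MvPowerSeries.coeff_X, MvPowerSeries.coeff_X]
        split_ifs <;> rfl
      change MvPowerSeries.map (ρ n : S →+* ℝ) (ψ' _) = _
      rw [h1, MvPowerSeries.map_X]
  obtain ⟨j, K, hjK⟩ := hno n xf yf hxf hyf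
  have h0 : θ' (familyPolyPower (h j)) = 0 := by
    have h1 : ψ' (familyPolyPower (h j)) = 0 := by
      ext e
      rw [hψ', hψ0 _ (hker j)]
      rfl
    change MvPowerSeries.map (ρ n : S →+* ℝ) (ψ' _) = _
    rw [h1, map_zero]
  obtain ⟨C, ε, hε, hb⟩ := (hθ'.bound_iff hyf0 (h j) K).2 (by rw [h0]; exact Ideal.zero_mem _)
  obtain ⟨u, hu, hu'⟩ := hjK C ε hε
  exact absurd (hb u hu) (not_le.2 hu')
end
end

section
/- Let W_0, W_1 and W̃ be finite-dimensional real vector spaces with fixed bases and corresponding linear coordinates x_0, x_1 and x̃. Let φ : (W_0 × W_1, W_0) → (W̃, 0) be a germ at W_0 of a real-analytic map whose components are in the ring R_ℝ(W_0 × W_1, W_0) and which maps W_0 × {0} to 0. Then for every germ f̃ : (W̃, 0) → ℝ of a real-analytic function, there exists f ∈ R_ℝ(W_0 × W_1, W_0) such that f(x_0, x_1) = f̃(φ(x_0, x_1)). -/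
open scoped BigOperators

noncomputable section

/-- Iterated directional (real) derivative along a list of directions. -/
def iterDerivR {E F : Type*} [NormedAddCommGroup E] [NormedSpace ℝ E]
    [NormedAddCommGroup F] [NormedSpace ℝ F] : List E → (E → F) → E → F
  | [], f => f
  | v :: vs, f => iterDerivR vs fun x => fderiv ℝ f x v

/-- Real polynomial functions on a real vector space. -/
inductive IsPolyFunR {V : Type*} [AddCommGroup V] [Module ℝ V] : (V → ℝ) → Prop
  | const (c : ℝ) : IsPolyFunR fun _ => c
  | linear (φ : V →ₗ[ℝ] ℝ) : IsPolyFunR fun x => φ x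
  | add {f g : V → ℝ} : IsPolyFunR f → IsPolyFunR g → IsPolyFunR fun x => f x + g x
  | mul {f g : V → ℝ} : IsPolyFunR f → IsPolyFunR g → IsPolyFunR fun x => f x * g x

/-- The ring `R_ℝ(W₀ × W₁, W₀)` of germs along `W₀ × {0}` of real-analytic functions all
of whose partial derivatives restrict to real polynomial functions on `W₀ × {0}`. -/
def MemRingR (W0 W1 : Type*) [NormedAddCommGroup W0] [NormedSpace ℝ W0]
    [NormedAddCommGroup W1] [NormedSpace ℝ W1] (f : W0 × W1 → ℝ) : Prop :=
  (∃ Ω : Set (W0 × W1), IsOpen Ω ∧ (∀ x0 : W0, ((x0, 0) : W0 × W1) ∈ Ω) ∧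
    AnalyticOnNhd ℝ f Ω) ∧
  ∀ vs : List (W0 × W1), IsPolyFunR fun x0 : W0 => iterDerivR vs f ((x0, 0) : W0 × W1)

section

variable {W0 W1 : Type*} [NormedAddCommGroup W0] [NormedSpace ℝ W0]
  [NormedAddCommGroup W1] [NormedSpace ℝ W1]

/-- `h` is analytic along `W₀ × {0}` and its iterated directional derivatives of order at most `n`
restrict to polynomial functions there. -/
def PolyDerivsUpTo : ℕ → (W0 × W1 → ℝ) → Prop
  | 0, h => (∀ x : W0, AnalyticAt ℝ h (x, 0)) ∧ IsPolyFunR fun x : W0 => h (x, 0)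
  | n + 1, h => ((∀ x : W0, AnalyticAt ℝ h (x, 0)) ∧ IsPolyFunR fun x : W0 => h (x, 0)) ∧
      ∀ v : W0 × W1, PolyDerivsUpTo n fun p => fderiv ℝ h p v

namespace PolyDerivsUpTo

theorem of_succ {n : ℕ} {h : W0 × W1 → ℝ} (H : PolyDerivsUpTo (n + 1) h) :
    PolyDerivsUpTo n h := by
  induction n generalizing h with
  | zero => exact H.1
  | succ n ih => exact ⟨H.1, fun v => ih (H.2 v)⟩

theorem congr {n : ℕ} {h k : W0 × W1 → ℝ} (H : PolyDerivsUpTo n h)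
    (e : ∀ x : W0, h =ᶠ[nhds (x, 0)] k) : PolyDerivsUpTo n k := by
  have base {h k : W0 × W1 → ℝ} (H : (∀ x : W0, AnalyticAt ℝ h (x, 0)) ∧
      IsPolyFunR fun x : W0 => h (x, 0)) (e : ∀ x : W0, h =ᶠ[nhds (x, 0)] k) :
      (∀ x : W0, AnalyticAt ℝ k (x, 0)) ∧ IsPolyFunR fun x : W0 => k (x, 0) := by
    refine ⟨fun x => (H.1 x).congr (e x), ?_⟩
    have : (fun x : W0 => k (x, 0)) = fun x : W0 => h (x, 0) :=
      funext fun x => ((e x).eq_of_nhds).symm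
    rw [this]
    exact H.2
  induction n generalizing h k with
  | zero => exact base H e
  | succ n ih =>
    refine ⟨base H.1 e, fun v => ih (H.2 v) fun x => ?_⟩
    filter_upwards [(e x).fderiv (𝕜 := ℝ)] with p hp
    rw [hp]

theorem zero (n : ℕ) : PolyDerivsUpTo n (fun _ : W0 × W1 => (0 : ℝ)) := by
  induction n with
  | zero => exact ⟨fun x => analyticAt_const, .const 0⟩
  | succ n ih => exact ⟨⟨fun x => analyticAt_const, .const 0⟩, fun v => by simpa using ih⟩

theorem add {n : ℕ} {h k : W0 × W1 → ℝ} (H : PolyDerivsUpTo n h) (K : PolyDerivsUpTo n k) :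
    PolyDerivsUpTo n fun p => h p + k p := by
  induction n generalizing h k with
  | zero => exact ⟨fun x => (H.1 x).fun_add (K.1 x), H.2.add K.2⟩
  | succ n ih =>
    refine ⟨⟨fun x => (H.1.1 x).fun_add (K.1.1 x), H.1.2.add K.1.2⟩,
      fun v => (ih (H.2 v) (K.2 v)).congr fun x => ?_⟩
    filter_upwards [(H.1.1 x).eventually_analyticAt, (K.1.1 x).eventually_analyticAt] with p hp kp
    rw [fderiv_fun_add hp.differentiableAt kp.differentiableAt]
    rfl

theorem mul {n : ℕ} {h k : W0 × W1 → ℝ} (H : PolyDerivsUpTo n h) (K : PolyDerivsUpTo n k) :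
    PolyDerivsUpTo n fun p => h p * k p := by
  induction n generalizing h k with
  | zero => exact ⟨fun x => (H.1 x).fun_mul (K.1 x), H.2.mul K.2⟩
  | succ n ih =>
    refine ⟨⟨fun x => (H.1.1 x).fun_mul (K.1.1 x), H.1.2.mul K.1.2⟩,
      fun v => ((ih H.of_succ (K.2 v)).add (ih K.of_succ (H.2 v))).congr fun x => ?_⟩
    filter_upwards [(H.1.1 x).eventually_analyticAt, (K.1.1 x).eventually_analyticAt] with p hp kp
    rw [fderiv_fun_mul hp.differentiableAt kp.differentiableAt]
    rfl

theorem sum {n : ℕ} {ι : Type*} (s : Finset ι) {h : ι → W0 × W1 → ℝ}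
    (H : ∀ i, PolyDerivsUpTo n (h i)) : PolyDerivsUpTo n fun p => ∑ i ∈ s, h i p := by
  classical
  induction s using Finset.induction_on with
  | empty => simpa using zero n
  | insert i s hi ih => simpa [Finset.sum_insert hi] using (H i).add ih

theorem comp {m : ℕ} {φ : W0 × W1 → Fin m → ℝ} {g : (Fin m → ℝ) → ℝ} (n : ℕ)
    (hφ : ∀ n i, PolyDerivsUpTo n fun p => φ p i) (hφ0 : ∀ x : W0, φ (x, 0) = 0)
    (hg : AnalyticAt ℝ g 0) : PolyDerivsUpTo n fun p => g (φ p) := by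
  have φana (x : W0) : AnalyticAt ℝ φ (x, 0) :=
    analyticAt_pi_iff.2 fun i => (hφ 0 i).1 x
  have base {g : (Fin m → ℝ) → ℝ} (hg : AnalyticAt ℝ g 0) :
      (∀ x : W0, AnalyticAt ℝ (fun p => g (φ p)) (x, 0)) ∧
        IsPolyFunR fun x : W0 => g (φ (x, 0)) := by
    refine ⟨fun x => AnalyticAt.fun_comp (by rwa [hφ0 x]) (φana x), ?_⟩
    simp only [hφ0]
    exact .const _
  induction n generalizing g with
  | zero => exact base hg
  | succ n ih =>
    refine ⟨base hg, fun v => ?_⟩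
    have hpart (i : Fin m) : AnalyticAt ℝ (fun y => fderiv ℝ g y (Pi.single i 1)) 0 :=
      (ContinuousLinearMap.apply ℝ ℝ (Pi.single i (1 : ℝ) : Fin m → ℝ)).analyticAt _
        |>.fun_comp hg.fderiv
    refine (sum Finset.univ fun i => (ih (hpart i)).mul ((hφ (n + 1) i).2 v)).congr fun x => ?_
    have hgφ : ∀ᶠ p in nhds ((x, 0) : W0 × W1), AnalyticAt ℝ g (φ p) := by
      refine (φana x).continuousAt.eventually ?_
      rw [hφ0 x]
      exact hg.eventually_analyticAt
    filter_upwards [hgφ, (φana x).eventually_analyticAt] with p hgp hφp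
    have hcomp : fderiv ℝ (fun p => g (φ p)) p = (fderiv ℝ g (φ p)).comp (fderiv ℝ φ p) :=
      fderiv_comp p hgp.differentiableAt hφp.differentiableAt
    have hcoord (i : Fin m) : fderiv ℝ (fun p => φ p i) p v = fderiv ℝ φ p v i := by
      rw [fderiv_apply hφp.differentiableAt]
      rfl
    simp only [hcoord]
    rw [hcomp, ContinuousLinearMap.comp_apply]
    conv_rhs => rw [pi_eq_sum_univ' (fderiv ℝ φ p v), map_sum]
    refine Finset.sum_congr rfl fun i _ => ?_
    rw [map_smul, smul_eq_mul, mul_comm]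

theorem isPolyFunR_iterDerivR {h : W0 × W1 → ℝ} (vs : List (W0 × W1))
    (H : PolyDerivsUpTo vs.length h) : IsPolyFunR fun x : W0 => iterDerivR vs h (x, 0) := by
  induction vs generalizing h with
  | nil => exact H.2
  | cons v vs ih => exact ih (H.2 v)

theorem of_iterDerivR (n : ℕ) {h : W0 × W1 → ℝ} (ha : ∀ x : W0, AnalyticAt ℝ h (x, 0))
    (hp : ∀ vs : List (W0 × W1), IsPolyFunR fun x : W0 => iterDerivR vs h (x, 0)) :
    PolyDerivsUpTo n h := by
  induction n generalizing h with
  | zero => exact ⟨ha, hp []⟩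
  | succ n ih =>
    exact ⟨⟨ha, hp []⟩, fun v => ih
      (fun x => (ContinuousLinearMap.apply ℝ ℝ v).analyticAt _ |>.fun_comp (ha x).fderiv)
      fun vs => hp (v :: vs)⟩

end PolyDerivsUpTo

theorem memRingR_iff_polyDerivsUpTo {h : W0 × W1 → ℝ} :
    MemRingR W0 W1 h ↔ ∀ n, PolyDerivsUpTo n h := by
  constructor
  · rintro ⟨⟨Ω, -, h0, ha⟩, hp⟩ n
    exact .of_iterDerivR n (fun x => ha _ (h0 x)) hp
  · intro H
    exact ⟨⟨{p | AnalyticAt ℝ h p}, isOpen_analyticAt ℝ h, (H 0).1, fun _ hp => hp⟩,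
      fun vs => (H vs.length).isPolyFunR_iterDerivR⟩

end

theorem statement16 (a b m : ℕ)
    (φ : ((Fin a → ℝ) × (Fin b → ℝ)) → (Fin m → ℝ))
    -- the components of `φ` are in the ring `R_ℝ(W₀ × W₁, W₀)`
    (hφmem : ∀ i : Fin m, MemRingR (Fin a → ℝ) (Fin b → ℝ) (fun p => φ p i))
    -- `φ` maps `W₀ × {0}` to `0`
    (hφ0 : ∀ x0 : Fin a → ℝ, φ (x0, 0) = 0)
    (ftilde : (Fin m → ℝ) → ℝ) (hft : AnalyticAt ℝ ftilde 0) :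
    ∃ f : (Fin a → ℝ) × (Fin b → ℝ) → ℝ,
      MemRingR (Fin a → ℝ) (Fin b → ℝ) f ∧
      ∃ Ω : Set ((Fin a → ℝ) × (Fin b → ℝ)), IsOpen Ω ∧
        (∀ x0 : Fin a → ℝ, ((x0, 0) : (Fin a → ℝ) × (Fin b → ℝ)) ∈ Ω) ∧
        ∀ p ∈ Ω, f p = ftilde (φ p) := by
  refine ⟨fun p => ftilde (φ p), memRingR_iff_polyDerivsUpTo.2 fun n => ?_, Set.univ, isOpen_univ,
    fun _ => Set.mem_univ _, fun _ _ => rfl⟩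
  exact .comp n (fun n i => memRingR_iff_polyDerivsUpTo.1 (hφmem i) n) hφ0 hft
end
end
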